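/- arXiv:2201.13050 — 2 statements merged into one kernel-verified Lean document; each statement's English description precedes it below -/
import Mathlib

section
/- Let d ∈ ℕ, 1 < q < ∞ and let κ satisfy 1/q ≤ κ ≤ 1 − 1/q. Then there exists a constant C > 0 such that for every Schwartz function u : ℝ^d → ℂ one has ‖u‖_q ≤ C · ‖⟨D⟩^{d(1 − 1/q)}u‖_1^{1−κ} · ‖⟨D⟩^{−d/q}u‖_∞^{κ}. -/
open MeasureTheory Real SchwartzMap
open scoped FourierTransform ENNReal NNReal


theorem gn_flip {d : ℕ} (f g : EuclideanSpace ℝ (Fin d) → ℂ) (hf : Integrable f)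
    (hg : Integrable g) : ∫ x, 𝓕⁻ f x * g x = ∫ x, f x * 𝓕⁻ g x := by
  have h := VectorFourier.integral_fourierIntegral_smul_eq_flip (μ := volume) (ν := volume)
    (L := -innerₗ (EuclideanSpace ℝ (Fin d))) (f := f) (g := g) (e := 𝐞)
    Real.continuous_fourierChar (by simpa using! continuous_inner.neg) hf hg
  have h2 : (-innerₗ (EuclideanSpace ℝ (Fin d))).flip = -innerₗ (EuclideanSpace ℝ (Fin d)) := by
    ext x y
    simp [real_inner_comm]
  rw [h2] at h
  exact h

theorem gn_gauss_integrable {d : ℕ} (b : ℝ) (hb : 0 < b) :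
    Integrable (fun v : EuclideanSpace ℝ (Fin d) => rexp (-b * ‖v‖ ^ 2)) := by
  have := (GaussianFourier.integrable_cexp_neg_mul_sq_norm_add (b := (b : ℂ)) (by simpa using hb) 0
    (0 : EuclideanSpace ℝ (Fin d))).norm
  refine this.congr (Filter.Eventually.of_forall fun v => ?_)
  simp only [Complex.norm_exp]
  congr 1
  simp [← Complex.ofReal_pow]

theorem gn_heat {d : ℕ} (V : EuclideanSpace ℝ (Fin d) → ℂ) (hV : Integrable V) (M : ℝ)
    (hM : ∀ x, ‖𝓕⁻ V x‖ ≤ M) (s : ℝ) (hs : 0 < s) (x : EuclideanSpace ℝ (Fin d)) :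
    ‖𝓕⁻ (fun ξ => ((rexp (-s * (1 + ‖ξ‖ ^ 2)) : ℝ) : ℂ) * V ξ) x‖ ≤ M := by
  have hM0 : 0 ≤ M := (norm_nonneg _).trans (hM 0)
  have hsre : 0 < (s : ℂ).re := by simpa using hs
  set h : EuclideanSpace ℝ (Fin d) → ℂ := fun v =>
    Complex.exp (-(s : ℂ) * ‖v‖ ^ 2 + 2 * π * Complex.I * inner ℝ x v) with hh
  have hint : Integrable h := GaussianFourier.integrable_cexp_neg_mul_sq_norm_add hsre _ x
  have hcont : Continuous h := by
    rw [hh]; fun_prop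
  have hF : 𝓕 h = fun w => ((((π / s) ^ ((d : ℝ) / 2) * rexp (-(π ^ 2 / s) * ‖w - x‖ ^ 2) : ℝ)) : ℂ) := by
    ext w
    rw [hh, fourier_gaussian_innerProductSpace' hsre x w]
    rw [norm_sub_rev x w]
    push_cast
    rw [Complex.ofReal_cpow (by positivity)]
    congr 2
    · simp
    · simp
    · ring
  have hgi : Integrable (fun w : EuclideanSpace ℝ (Fin d) => (π / s) ^ ((d : ℝ) / 2) * rexp (-(π ^ 2 / s) * ‖w - x‖ ^ 2)) :=
    ((gn_gauss_integrable (d := d) (π ^ 2 / s) (by positivity)).comp_sub_right x).const_mul _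
  have hFint : Integrable (𝓕 h) := by
    rw [hF]; exact hgi.ofReal
  have hinv : 𝓕⁻ (𝓕 h) = h := hcont.fourierInv_fourier_eq hint hFint
  have key : 𝓕⁻ (fun ξ => ((rexp (-s * (1 + ‖ξ‖ ^ 2)) : ℝ) : ℂ) * V ξ) x
      = (rexp (-s) : ℂ) * ∫ w, 𝓕 h w * 𝓕⁻ V w := by
    rw [← gn_flip _ _ hFint hV, hinv, ← integral_const_mul, Real.fourierInv_eq']
    congr 1
    ext ξ
    simp only [hh, smul_eq_mul, ← mul_assoc]
    congr 1
    push_cast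
    rw [← Complex.exp_add, ← Complex.exp_add, real_inner_comm]
    congr 1
    ring
  have htot : ∫ w : EuclideanSpace ℝ (Fin d), (π / s) ^ ((d : ℝ) / 2) * rexp (-(π ^ 2 / s) * ‖w - x‖ ^ 2) = 1 := by
    rw [integral_const_mul]
    rw [integral_sub_right_eq_self (fun w : EuclideanSpace ℝ (Fin d) => rexp (-(π ^ 2 / s) * ‖w‖ ^ 2)) x]
    rw [GaussianFourier.integral_rexp_neg_mul_sq_norm (by positivity), finrank_euclideanSpace_fin]
    rw [← mul_rpow (by positivity) (by positivity)]
    have : π / s * (π / (π ^ 2 / s)) = 1 := by field_simp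
    rw [this, one_rpow]
  have hb : ‖∫ w, 𝓕 h w * 𝓕⁻ V w‖ ≤ M := by
    calc ‖∫ w, 𝓕 h w * 𝓕⁻ V w‖ ≤ ∫ w : EuclideanSpace ℝ (Fin d), ((π / s) ^ ((d : ℝ) / 2) * rexp (-(π ^ 2 / s) * ‖w - x‖ ^ 2)) * M := by
          apply norm_integral_le_of_norm_le (hgi.mul_const M)
          refine Filter.Eventually.of_forall fun w => ?_
          rw [norm_mul, hF]
          simp only [Complex.norm_real]
          rw [Real.norm_of_nonneg (by positivity)]
          exact mul_le_mul_of_nonneg_left (hM w) (by positivity)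
      _ = M := by rw [integral_mul_const, htot, one_mul]
  rw [key, norm_mul, Complex.norm_real, Real.norm_of_nonneg (exp_pos _).le]
  calc _ ≤ 1 * M := by
        apply mul_le_mul _ hb (norm_nonneg _) zero_le_one
        rw [exp_le_one_iff]; linarith
    _ = M := one_mul M

theorem gn_plancherel {d : ℕ} (F : EuclideanSpace ℝ (Fin d) → ℂ) (hF : Integrable F)
    (hF2 : MemLp F 2 volume) : eLpNorm (𝓕⁻ F) 2 volume = eLpNorm F 2 volume := by
  have hcont : Continuous (𝓕⁻ F) :=
    VectorFourier.fourierIntegral_continuous Real.continuous_fourierChar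
      (by simpa using! continuous_inner.neg) hF
  set Fl := hF2.toLp F with hFl
  have hG : ∀ᵐ x, (𝓕⁻ Fl : Lp (α := EuclideanSpace ℝ (Fin d)) ℂ 2 volume) x = 𝓕⁻ F x := by
    apply ae_eq_of_integral_contDiff_smul_eq
    · exact (Lp.memLp (𝓕⁻ Fl)).locallyIntegrable (by norm_num)
    · exact hcont.locallyIntegrable
    · intro g hg hgc
      have hg1 : ContDiff ℝ (⊤ : ℕ∞) (fun x => (g x : ℂ)) := Complex.ofRealCLM.contDiff.comp hg
      have hgc1 : HasCompactSupport (fun x => (g x : ℂ)) := hgc.comp_left (g := Complex.ofReal) (by simp)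
      set φ := hgc1.toSchwartzMap hg1 with hφ
      have hφx : ∀ x, φ x = (g x : ℂ) := fun x => rfl
      have h1 := congrArg (fun T => T φ) (Lp.fourierInv_toTemperedDistribution_eq Fl)
      simp only [TemperedDistribution.fourierInv_apply, Lp.toTemperedDistribution_apply] at h1
      have h2 : ∫ x, (𝓕⁻ φ) x • Fl x = ∫ x, 𝓕⁻ (φ : _ → ℂ) x * F x := by
        apply integral_congr_ae
        filter_upwards [hF2.coeFn_toLp] with x hx
        rw [hFl, hx, SchwartzMap.fourierInv_coe, smul_eq_mul]
      rw [h2, gn_flip _ _ φ.integrable hF] at h1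
      simp only [hφx] at h1
      simpa using h1.symm
  rw [← eLpNorm_congr_ae hG, ← eLpNorm_congr_ae hF2.coeFn_toLp]
  have h3 : ‖(𝓕⁻ Fl : Lp (α := EuclideanSpace ℝ (Fin d)) ℂ 2 volume)‖ = ‖Fl‖ :=
    (Lp.fourierTransformₗᵢ (EuclideanSpace ℝ (Fin d)) ℂ).symm.norm_map Fl
  rw [Lp.norm_def, Lp.norm_def] at h3
  exact (ENNReal.toReal_eq_toReal_iff' (Lp.eLpNorm_ne_top _) (Lp.eLpNorm_ne_top _)).1 h3


noncomputable def gnG (d : ℕ) (y : ℝ) : ℝ := (1 - rexp (-y)) ^ d * rexp (-y)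

theorem gnG_cont (d : ℕ) : Continuous (gnG d) := by unfold gnG; fun_prop

theorem gn_one_sub_nonneg {y : ℝ} (hy : 0 ≤ y) : 0 ≤ 1 - rexp (-y) := by
  have : rexp (-y) ≤ 1 := by rw [exp_le_one_iff]; linarith
  linarith

theorem gn_one_sub_le_one {y : ℝ} : 1 - rexp (-y) ≤ 1 := by
  have := exp_pos (-y)
  linarith

theorem gn_one_sub_le {y : ℝ} : 1 - rexp (-y) ≤ y := by
  have := add_one_le_exp (-y)
  linarith

theorem gnG_nonneg (d : ℕ) {y : ℝ} (hy : 0 ≤ y) : 0 ≤ gnG d y :=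
  mul_nonneg (pow_nonneg (gn_one_sub_nonneg hy) _) (exp_pos _).le

theorem gnG_le_exp (d : ℕ) {y : ℝ} (hy : 0 ≤ y) : gnG d y ≤ rexp (-y) := by
  unfold gnG
  have := pow_le_one₀ (n := d) (gn_one_sub_nonneg hy) gn_one_sub_le_one
  have h2 := exp_pos (-y)
  nlinarith

theorem gnG_le_one (d : ℕ) {y : ℝ} (hy : 0 ≤ y) : gnG d y ≤ 1 :=
  (gnG_le_exp d hy).trans (by rw [exp_le_one_iff]; linarith)

theorem gnG_le_pow (d : ℕ) {y : ℝ} (hy : 0 ≤ y) : gnG d y ≤ y ^ d := by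
  unfold gnG
  have h1 := pow_le_pow_left₀ (gn_one_sub_nonneg hy) gn_one_sub_le d
  have h2 : rexp (-y) ≤ 1 := by rw [exp_le_one_iff]; linarith
  have h3 : (0 : ℝ) ≤ y ^ d := by positivity
  calc _ ≤ y ^ d * 1 := mul_le_mul h1 h2 (exp_pos _).le h3
    _ = _ := mul_one _

theorem gnG_le_rpow_mul (d : ℕ) {y : ℝ} (hy : 0 ≤ y) :
    gnG d y ≤ y ^ ((d : ℝ) / 2) * rexp (-y) := by
  unfold gnG
  apply mul_le_mul_of_nonneg_right _ (exp_pos _).le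
  have h0 := gn_one_sub_nonneg hy
  calc (1 - rexp (-y)) ^ d = (1 - rexp (-y)) ^ (d : ℝ) := (rpow_natCast _ _).symm
    _ ≤ (1 - rexp (-y)) ^ ((d : ℝ) / 2) := by
        rcases h0.eq_or_lt with h | h
        · rw [← h]
          rcases Nat.eq_zero_or_pos d with hd | hd
          · simp [hd]
          · rw [zero_rpow (by positivity), zero_rpow (by positivity)]
        · apply rpow_le_rpow_of_exponent_ge h gn_one_sub_le_one
          have : (0 : ℝ) ≤ d := by positivity
          linarith
    _ ≤ _ := rpow_le_rpow h0 gn_one_sub_le (by positivity)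

theorem gn_kernel_le_left (d : ℕ) (α : ℝ) {s x : ℝ} (hs : 0 < s) (hx : 0 < x) :
    s ^ (-α - 1) * gnG d (s * x) ≤ x ^ d * s ^ ((d : ℝ) - α - 1) := by
  calc s ^ (-α - 1) * gnG d (s * x) ≤ s ^ (-α - 1) * (s * x) ^ d :=
        mul_le_mul_of_nonneg_left (gnG_le_pow d (by positivity)) (by positivity)
    _ = x ^ d * s ^ ((d : ℝ) - α - 1) := by
        rw [mul_pow, show (d : ℝ) - α - 1 = (-α - 1) + d by ring, rpow_add hs, rpow_natCast]
        ring

theorem gn_kernel_le_right (d : ℕ) (α : ℝ) {s x : ℝ} (hs : 0 < s) (hx : 0 < x) :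
    s ^ (-α - 1) * gnG d (s * x) ≤ s ^ (-α - 1) := by
  calc s ^ (-α - 1) * gnG d (s * x) ≤ s ^ (-α - 1) * 1 :=
        mul_le_mul_of_nonneg_left (gnG_le_one d (by positivity)) (by positivity)
    _ = _ := mul_one _

theorem gn_kernel_nonneg (d : ℕ) (α : ℝ) {s x : ℝ} (hs : 0 < s) (hx : 0 < x) :
    0 ≤ s ^ (-α - 1) * gnG d (s * x) :=
  mul_nonneg (by positivity) (gnG_nonneg d (by positivity))

theorem gn_kernel_meas (d : ℕ) (α : ℝ) (x : ℝ) :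
    Measurable (fun s : ℝ => s ^ (-α - 1) * gnG d (s * x)) := by
  have := (gnG_cont d).measurable
  fun_prop

theorem gn_intOn_right (d : ℕ) {α : ℝ} (hα : 0 < α) {x t : ℝ} (hx : 0 < x) (ht : 0 < t) :
    IntegrableOn (fun s : ℝ => s ^ (-α - 1) * gnG d (s * x)) (Set.Ioi t) := by
  apply Integrable.mono' (integrableOn_Ioi_rpow_of_lt (a := -α - 1) (by linarith) ht)
    (gn_kernel_meas d α x).aestronglyMeasurable
  filter_upwards [ae_restrict_mem measurableSet_Ioi] with s hs
  have hs0 : 0 < s := ht.trans hs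
  rw [Real.norm_of_nonneg (gn_kernel_nonneg d α hs0 hx)]
  exact gn_kernel_le_right d α hs0 hx

theorem gn_intOn_pow (d : ℕ) {α : ℝ} (hαd : α < d) {t : ℝ} (ht : 0 < t) :
    IntegrableOn (fun s : ℝ => s ^ ((d : ℝ) - α - 1)) (Set.Ioc 0 t) := by
  have := (intervalIntegral.intervalIntegrable_rpow' (a := 0) (b := t) (r := (d : ℝ) - α - 1) (by linarith))
  rwa [intervalIntegrable_iff_integrableOn_Ioc_of_le ht.le] at this

theorem gn_intOn_left (d : ℕ) {α : ℝ} (hαd : α < d) {x t : ℝ} (hx : 0 < x) (ht : 0 < t) :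
    IntegrableOn (fun s : ℝ => s ^ (-α - 1) * gnG d (s * x)) (Set.Ioc 0 t) := by
  apply Integrable.mono' ((gn_intOn_pow d hαd ht).const_mul (x ^ d))
    (gn_kernel_meas d α x).aestronglyMeasurable
  filter_upwards [ae_restrict_mem measurableSet_Ioc] with s hs
  rw [Real.norm_of_nonneg (gn_kernel_nonneg d α hs.1 hx)]
  exact gn_kernel_le_left d α hs.1 hx

noncomputable def gnH (d : ℕ) (α t x : ℝ) : ℝ := ∫ s in Set.Ioc 0 t, s ^ (-α - 1) * gnG d (s * x)
noncomputable def gnL (d : ℕ) (α t x : ℝ) : ℝ := ∫ s in Set.Ioi t, s ^ (-α - 1) * gnG d (s * x)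
noncomputable def gnC (d : ℕ) (α : ℝ) : ℝ := ∫ s in Set.Ioi (0 : ℝ), s ^ (-α - 1) * gnG d (s * 1)

theorem gn_scale (d : ℕ) {α : ℝ} {x : ℝ} (hx : 0 < x) :
    ∫ s in Set.Ioi (0 : ℝ), s ^ (-α - 1) * gnG d (s * x) = gnC d α * x ^ α := by
  have h := integral_comp_mul_right_Ioi (fun s : ℝ => s ^ (-α - 1) * gnG d (s * 1)) 0 hx
  have h2 : ∫ s in Set.Ioi (0 : ℝ), (s * x) ^ (-α - 1) * gnG d (s * x * 1)
      = x ^ (-α - 1) * ∫ s in Set.Ioi (0 : ℝ), s ^ (-α - 1) * gnG d (s * x) := by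
    rw [← integral_const_mul]
    apply setIntegral_congr_fun measurableSet_Ioi
    intro s hs
    have hs0 : (0 : ℝ) < s := hs
    simp only [mul_one]
    rw [mul_rpow hs0.le hx.le]
    ring
  rw [h2, zero_mul] at h
  unfold gnC
  have h3 : x ^ (-α - 1) = (x ^ α)⁻¹ * x⁻¹ := by
    rw [rpow_sub hx, rpow_neg hx.le, rpow_one, div_eq_mul_inv]
  rw [h3, smul_eq_mul] at h
  have h4 : 0 < x ^ α := by positivity
  generalize (∫ s in Set.Ioi (0 : ℝ), s ^ (-α - 1) * gnG d (s * x)) = I at h ⊢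
  generalize (∫ s in Set.Ioi (0 : ℝ), s ^ (-α - 1) * gnG d (s * 1)) = J at h ⊢
  field_simp at h
  linarith

theorem gn_add (d : ℕ) {α : ℝ} (hα : 0 < α) (hαd : α < d) {x t : ℝ} (hx : 0 < x) (ht : 0 < t) :
    gnH d α t x + gnL d α t x = gnC d α * x ^ α := by
  rw [← gn_scale d hx, ← Set.Ioc_union_Ioi_eq_Ioi ht.le,
    setIntegral_union (Set.Ioc_disjoint_Ioi le_rfl) measurableSet_Ioi (gn_intOn_left d hαd hx ht)
    (gn_intOn_right d hα hx ht)]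
  rfl

theorem gnL_nonneg (d : ℕ) {α : ℝ} {x t : ℝ} (hx : 0 < x) (ht : 0 < t) : 0 ≤ gnL d α t x :=
  setIntegral_nonneg measurableSet_Ioi fun _ hs => gn_kernel_nonneg d α (ht.trans hs) hx

theorem gnH_nonneg (d : ℕ) {α : ℝ} {x t : ℝ} (hx : 0 < x) : 0 ≤ gnH d α t x :=
  setIntegral_nonneg measurableSet_Ioc fun _ hs => gn_kernel_nonneg d α hs.1 hx

theorem gnH_le (d : ℕ) {α : ℝ} (hα : 0 < α) (hαd : α < d) {x t : ℝ} (hx : 0 < x) (ht : 0 < t) :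
    gnH d α t x ≤ gnC d α * x ^ α := by
  have := gn_add d hα hαd hx ht
  have := gnL_nonneg d (α := α) hx ht
  linarith

theorem gnH_le' (d : ℕ) {α : ℝ} (hαd : α < d) {x t : ℝ} (hx : 0 < x) (ht : 0 < t) :
    gnH d α t x ≤ x ^ d * (t ^ ((d : ℝ) - α) / (d - α)) := by
  calc gnH d α t x ≤ ∫ s in Set.Ioc 0 t, x ^ d * s ^ ((d : ℝ) - α - 1) :=
        setIntegral_mono_on (gn_intOn_left d hαd hx ht) ((gn_intOn_pow d hαd ht).const_mul (x ^ d))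
          measurableSet_Ioc fun s hs => gn_kernel_le_left d α hs.1 hx
    _ = _ := by
        rw [integral_const_mul, ← intervalIntegral.integral_of_le ht.le,
          integral_rpow (Or.inl (by linarith))]
        rw [sub_add_cancel, zero_rpow (by linarith), sub_zero]

theorem gnC_pos (d : ℕ) {α : ℝ} (hα : 0 < α) (hαd : α < d) : 0 < gnC d α := by
  unfold gnC
  rw [setIntegral_pos_iff_support_of_nonneg_ae]
  · have : Set.Ioi (0 : ℝ) ⊆ (Function.support fun s : ℝ => s ^ (-α - 1) * gnG d (s * 1)) := by
      intro s hs
      have hs0 : (0 : ℝ) < s := hs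
      have : 0 < 1 - rexp (-(s * 1)) := by
        have : rexp (-(s * 1)) < 1 := by rw [exp_lt_one_iff]; linarith
        linarith
      have h : 0 < s ^ (-α - 1) * gnG d (s * 1) := by
        unfold gnG; positivity
      exact h.ne'
    rw [Set.inter_eq_right.2 this]
    simp
  · filter_upwards [ae_restrict_mem measurableSet_Ioi] with s hs
    exact gn_kernel_nonneg d α hs one_pos
  · rw [← Set.Ioc_union_Ioi_eq_Ioi zero_le_one]
    exact (gn_intOn_left d hαd one_pos one_pos).union (gn_intOn_right d hα one_pos one_pos)

theorem gn_one_sub_heat {d : ℕ} (n : ℕ) (s : ℝ) (hs : 0 < s) (M : ℝ) :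
    ∀ (V : EuclideanSpace ℝ (Fin d) → ℂ), Integrable V → (∀ x, ‖𝓕⁻ V x‖ ≤ M) →
    Integrable (fun ξ => (((1 - rexp (-(s * (1 + ‖ξ‖ ^ 2)))) ^ n : ℝ) : ℂ) * V ξ) ∧
    ∀ x, ‖𝓕⁻ (fun ξ => (((1 - rexp (-(s * (1 + ‖ξ‖ ^ 2)))) ^ n : ℝ) : ℂ) * V ξ) x‖ ≤ 2 ^ n * M := by
  induction n with
  | zero => intro V hV hM; simpa using ⟨hV, hM⟩
  | succ n ih =>
    intro V hV hM
    obtain ⟨hi, hb⟩ := ih V hV hM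
    set W : EuclideanSpace ℝ (Fin d) → ℂ :=
      fun ξ => (((1 - rexp (-(s * (1 + ‖ξ‖ ^ 2)))) ^ n : ℝ) : ℂ) * V ξ with hW
    have hE : Integrable (fun ξ => ((rexp (-s * (1 + ‖ξ‖ ^ 2)) : ℝ) : ℂ) * W ξ) := by
      apply hi.bdd_mul (c := 1)
      · apply Continuous.aestronglyMeasurable
        fun_prop
      · refine Filter.Eventually.of_forall fun ξ => ?_
        rw [Complex.norm_real, Real.norm_of_nonneg (exp_pos _).le, exp_le_one_iff]
        nlinarith [sq_nonneg ‖ξ‖]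
    have heq : (fun ξ => (((1 - rexp (-(s * (1 + ‖ξ‖ ^ 2)))) ^ (n + 1) : ℝ) : ℂ) * V ξ)
        = fun ξ => W ξ - ((rexp (-s * (1 + ‖ξ‖ ^ 2)) : ℝ) : ℂ) * W ξ := by
      ext ξ
      simp only [hW]
      push_cast
      rw [neg_mul]
      ring
    rw [heq]
    refine ⟨hi.sub hE, fun x => ?_⟩
    have hsub : 𝓕⁻ (fun ξ => W ξ - ((rexp (-s * (1 + ‖ξ‖ ^ 2)) : ℝ) : ℂ) * W ξ) x
        = 𝓕⁻ W x - 𝓕⁻ (fun ξ => ((rexp (-s * (1 + ‖ξ‖ ^ 2)) : ℝ) : ℂ) * W ξ) x := by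
      simp only [Real.fourierInv_eq]
      rw [← integral_sub]
      · simp only [smul_sub]
      · simpa using (Real.fourierIntegral_convergent_iff (-x)).2 hi
      · simpa using (Real.fourierIntegral_convergent_iff (-x)).2 hE
    rw [hsub]
    have h1 := hb x
    have h2 := gn_heat W hi _ hb s hs x
    calc _ ≤ _ := norm_sub_le _ _
      _ ≤ 2 ^ n * M + 2 ^ n * M := add_le_add h1 h2
      _ = _ := by ring

theorem gn_bound_sup {d : ℕ} (s : ℝ) (hs : 0 < s) (M : ℝ)
    (V : EuclideanSpace ℝ (Fin d) → ℂ) (hV : Integrable V) (hM : ∀ x, ‖𝓕⁻ V x‖ ≤ M)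
    (x : EuclideanSpace ℝ (Fin d)) :
    ‖𝓕⁻ (fun ξ => ((gnG d (s * (1 + ‖ξ‖ ^ 2)) : ℝ) : ℂ) * V ξ) x‖ ≤ 2 ^ d * M := by
  obtain ⟨hi, hb⟩ := gn_one_sub_heat d s hs M V hV hM
  have h := gn_heat _ hi _ hb s hs x
  convert h using 4 with ξ
  unfold gnG
  push_cast
  rw [neg_mul]
  ring

theorem gn_bound_one {d : ℕ} (s : ℝ) (hs : 0 < s) (N : ℝ)
    (V : EuclideanSpace ℝ (Fin d) → ℂ)
    (hN : ∀ ξ, (1 + ‖ξ‖ ^ 2) ^ ((d : ℝ) / 2) * ‖V ξ‖ ≤ N)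
    (x : EuclideanSpace ℝ (Fin d)) :
    ‖𝓕⁻ (fun ξ => ((gnG d (s * (1 + ‖ξ‖ ^ 2)) : ℝ) : ℂ) * V ξ) x‖ ≤ π ^ ((d : ℝ) / 2) * N := by
  rw [Real.fourierInv_eq]
  calc _ ≤ ∫ ξ : EuclideanSpace ℝ (Fin d), (s ^ ((d : ℝ) / 2) * N) * rexp (-s * ‖ξ‖ ^ 2) := by
        apply norm_integral_le_of_norm_le ((gn_gauss_integrable s hs).const_mul _)
        refine Filter.Eventually.of_forall fun ξ => ?_
        rw [Circle.norm_smul, norm_mul, Complex.norm_real]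
        have hX : 0 < 1 + ‖ξ‖ ^ 2 := by positivity
        rw [Real.norm_of_nonneg (gnG_nonneg d (by positivity))]
        have hN0 : 0 ≤ N := le_trans (by positivity) (hN ξ)
        calc _ ≤ ((s * (1 + ‖ξ‖ ^ 2)) ^ ((d : ℝ) / 2) * rexp (-(s * (1 + ‖ξ‖ ^ 2)))) * ‖V ξ‖ :=
              mul_le_mul_of_nonneg_right (gnG_le_rpow_mul d (by positivity)) (norm_nonneg _)
          _ = s ^ ((d : ℝ) / 2) * ((1 + ‖ξ‖ ^ 2) ^ ((d : ℝ) / 2) * ‖V ξ‖)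
              * rexp (-(s * (1 + ‖ξ‖ ^ 2))) := by
              rw [mul_rpow hs.le hX.le]; ring
          _ ≤ s ^ ((d : ℝ) / 2) * N * rexp (-s * ‖ξ‖ ^ 2) := by
              apply mul_le_mul
              · exact mul_le_mul_of_nonneg_left (hN ξ) (by positivity)
              · rw [exp_le_exp]; nlinarith
              · positivity
              · positivity
    _ = _ := by
        rw [integral_const_mul, GaussianFourier.integral_rexp_neg_mul_sq_norm hs,
          finrank_euclideanSpace_fin, div_rpow pi_pos.le hs.le]
        have : 0 < s ^ ((d : ℝ) / 2) := by positivity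
        field_simp


theorem gn_low {d : ℕ} {α : ℝ} (hα : 0 < α) (V : EuclideanSpace ℝ (Fin d) → ℂ) (hV : Integrable V)
    (B : ℝ) (hB : ∀ s : ℝ, 0 < s → ∀ x : EuclideanSpace ℝ (Fin d),
      ‖𝓕⁻ (fun ξ => ((gnG d (s * (1 + ‖ξ‖ ^ 2)) : ℝ) : ℂ) * V ξ) x‖ ≤ B)
    {t : ℝ} (ht : 0 < t) (x : EuclideanSpace ℝ (Fin d)) :
    ‖𝓕⁻ (fun ξ => ((gnL d α t (1 + ‖ξ‖ ^ 2) : ℝ) : ℂ) * V ξ) x‖ ≤ B * (t ^ (-α) / α) := by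
  have hpi : IntegrableOn (fun s : ℝ => s ^ (-α - 1)) (Set.Ioi t) :=
    integrableOn_Ioi_rpow_of_lt (a := -α - 1) (by linarith) ht
  set Φ : EuclideanSpace ℝ (Fin d) → ℝ → ℂ := fun ξ s =>
    𝐞 (inner ℝ ξ x) • (((s ^ (-α - 1) * gnG d (s * (1 + ‖ξ‖ ^ 2)) : ℝ) : ℂ) * V ξ) with hΦ
  have hint : Integrable (Function.uncurry Φ)
      ((volume : Measure (EuclideanSpace ℝ (Fin d))).prod (volume.restrict (Set.Ioi t))) := by
    apply Integrable.mono' (hV.norm.mul_prod hpi)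
    · have h1 : AEStronglyMeasurable (fun p : EuclideanSpace ℝ (Fin d) × ℝ => V p.1)
        ((volume : Measure (EuclideanSpace ℝ (Fin d))).prod (volume.restrict (Set.Ioi t))) :=
        hV.1.comp_fst
      have h2 : Measurable (fun p : EuclideanSpace ℝ (Fin d) × ℝ =>
          ((p.2 ^ (-α - 1) * gnG d (p.2 * (1 + ‖p.1‖ ^ 2)) : ℝ) : ℂ)) := by
        have := (gnG_cont d).measurable
        fun_prop
      have h3 : Continuous (fun p : EuclideanSpace ℝ (Fin d) × ℝ => ((𝐞 (inner ℝ p.1 x) : Circle) : ℂ)) := by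
        have := Real.continuous_fourierChar
        fun_prop
      exact h3.aestronglyMeasurable.mul (h2.aestronglyMeasurable.mul h1)
    · have hae : ∀ᵐ p : EuclideanSpace ℝ (Fin d) × ℝ ∂((volume : Measure (EuclideanSpace ℝ (Fin d))).prod (volume.restrict (Set.Ioi t))), t < p.2 := by
        have := Measure.quasiMeasurePreserving_snd (μ := (volume : Measure (EuclideanSpace ℝ (Fin d)))) (ν := volume.restrict (Set.Ioi t))
        exact this.ae (ae_restrict_mem measurableSet_Ioi)
      filter_upwards [hae] with p hp
      have hs0 : 0 < p.2 := ht.trans hp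
      simp only [Function.uncurry, hΦ]
      rw [Circle.norm_smul, norm_mul, Complex.norm_real,
        Real.norm_of_nonneg (gn_kernel_nonneg d α hs0 (by positivity)), mul_comm]
      exact mul_le_mul_of_nonneg_left (gn_kernel_le_right d α hs0 (by positivity)) (norm_nonneg _)
  have key : 𝓕⁻ (fun ξ => ((gnL d α t (1 + ‖ξ‖ ^ 2) : ℝ) : ℂ) * V ξ) x
      = ∫ s in Set.Ioi t, ((s ^ (-α - 1) : ℝ) : ℂ) * 𝓕⁻ (fun ξ => ((gnG d (s * (1 + ‖ξ‖ ^ 2)) : ℝ) : ℂ) * V ξ) x := by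
    rw [Real.fourierInv_eq]
    calc _ = ∫ ξ, ∫ s in Set.Ioi t, Φ ξ s := by
          congr 1
          ext ξ
          simp only [hΦ, Circle.smul_def]
          rw [integral_smul, integral_mul_const, integral_complex_ofReal]
          rfl
      _ = ∫ s in Set.Ioi t, ∫ ξ, Φ ξ s := integral_integral_swap hint
      _ = _ := by
          congr 1
          ext s
          rw [Real.fourierInv_eq, ← integral_const_mul]
          congr 1
          ext ξ
          simp only [hΦ, Circle.smul_def, smul_eq_mul]
          push_cast
          ring
  rw [key]
  calc _ ≤ ∫ s in Set.Ioi t, s ^ (-α - 1) * B := by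
        apply norm_integral_le_of_norm_le (hpi.mul_const B)
        filter_upwards [ae_restrict_mem measurableSet_Ioi] with s hs
        have hs0 : 0 < s := ht.trans hs
        rw [norm_mul, Complex.norm_real, Real.norm_of_nonneg (by positivity)]
        exact mul_le_mul_of_nonneg_left (hB s hs0 x) (by positivity)
    _ = _ := by
        rw [integral_mul_const, integral_Ioi_rpow_of_lt (by linarith) ht]
        rw [sub_add_cancel, neg_div_neg_eq, mul_comm]

theorem gnL_meas (d : ℕ) (α t : ℝ) :
    Measurable (fun ξ : EuclideanSpace ℝ (Fin d) => gnL d α t (1 + ‖ξ‖ ^ 2)) := by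
  have : StronglyMeasurable (fun p : EuclideanSpace ℝ (Fin d) × ℝ =>
      p.2 ^ (-α - 1) * gnG d (p.2 * (1 + ‖p.1‖ ^ 2))) := by
    have := (gnG_cont d).measurable
    apply Measurable.stronglyMeasurable
    fun_prop
  exact (StronglyMeasurable.integral_prod_right (ν := volume.restrict (Set.Ioi t)) this).measurable

theorem gn_weak {d : ℕ} {α : ℝ} (hα : 0 < α) (hαd : α < d)
    (V U : SchwartzMap (EuclideanSpace ℝ (Fin d)) ℂ)
    (hUV : ∀ ξ, U ξ = (((1 + ‖ξ‖ ^ 2) ^ α : ℝ) : ℂ) * V ξ)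
    (B : ℝ) (hB : ∀ s : ℝ, 0 < s → ∀ x : EuclideanSpace ℝ (Fin d),
      ‖𝓕⁻ (fun ξ => ((gnG d (s * (1 + ‖ξ‖ ^ 2)) : ℝ) : ℂ) * V ξ) x‖ ≤ B)
    {t lam : ℝ} (ht : 0 < t) (hl : 0 < lam) (htl : B * (t ^ (-α) / α) ≤ gnC d α * lam / 2) :
    volume {x | lam < ‖𝓕⁻ (U : EuclideanSpace ℝ (Fin d) → ℂ) x‖} ≤
      ENNReal.ofReal ((gnC d α * lam / 2) ^ (-2 : ℝ)) *
        ∫⁻ ξ, ENNReal.ofReal (gnH d α t (1 + ‖ξ‖ ^ 2) ^ 2 * ‖V ξ‖ ^ 2) := by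
  have hC := gnC_pos d hα hαd
  set Hf : EuclideanSpace ℝ (Fin d) → ℂ := fun ξ => ((gnH d α t (1 + ‖ξ‖ ^ 2) : ℝ) : ℂ) * V ξ with hHf
  set Lf : EuclideanSpace ℝ (Fin d) → ℂ := fun ξ => ((gnL d α t (1 + ‖ξ‖ ^ 2) : ℝ) : ℂ) * V ξ with hLf
  have hsum : ∀ ξ, Hf ξ = (gnC d α : ℂ) * U ξ - Lf ξ := by
    intro ξ
    have := gn_add d hα hαd (x := 1 + ‖ξ‖ ^ 2) (by positivity) ht
    have h2 : gnH d α t (1 + ‖ξ‖ ^ 2) = gnC d α * (1 + ‖ξ‖ ^ 2) ^ α - gnL d α t (1 + ‖ξ‖ ^ 2) := by linarith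
    simp only [hHf, hLf, hUV, h2]
    push_cast
    ring
  have hLm : AEStronglyMeasurable Lf := by
    apply AEStronglyMeasurable.mul _ V.continuous.aestronglyMeasurable
    exact (Complex.measurable_ofReal.comp (gnL_meas d α t)).aestronglyMeasurable
  have hHm : AEStronglyMeasurable Hf := by
    rw [show Hf = fun ξ => (gnC d α : ℂ) * U ξ - Lf ξ from funext hsum]
    exact (U.continuous.aestronglyMeasurable.const_mul _).sub hLm
  have hHle : ∀ ξ, ‖Hf ξ‖ ≤ ‖(gnC d α : ℂ) * U ξ‖ := by
    intro ξ
    have hX : 0 < 1 + ‖ξ‖ ^ 2 := by positivity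
    simp only [hHf, hUV]
    rw [← mul_assoc, norm_mul, norm_mul, ← Complex.ofReal_mul, Complex.norm_real, Complex.norm_real,
      Real.norm_of_nonneg (gnH_nonneg d hX), Real.norm_of_nonneg (by positivity)]
    exact mul_le_mul_of_nonneg_right (gnH_le d hα hαd hX ht) (norm_nonneg _)
  have hHi : Integrable Hf := (U.integrable.const_mul (gnC d α : ℂ)).mono hHm
    (Filter.Eventually.of_forall hHle)
  have hH2 : MemLp Hf 2 volume := ((U.memLp 2 volume).const_mul (gnC d α : ℂ)).mono hHm
    (Filter.Eventually.of_forall hHle)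
  have hLi : Integrable Lf := by
    rw [show Lf = fun ξ => (gnC d α : ℂ) * U ξ - Hf ξ from funext fun ξ => by rw [hsum]; ring]
    exact (U.integrable.const_mul _).sub hHi
  have hF : ∀ x, 𝓕⁻ Hf x = (gnC d α : ℂ) * 𝓕⁻ (U : EuclideanSpace ℝ (Fin d) → ℂ) x - 𝓕⁻ Lf x := by
    intro x
    rw [show Hf = fun ξ => (gnC d α : ℂ) * U ξ - Lf ξ from funext hsum]
    simp only [Real.fourierInv_eq]
    rw [← integral_const_mul, ← integral_sub]
    · congr 1
      ext ξ
      simp only [Circle.smul_def, smul_eq_mul]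
      ring
    · simpa using ((Real.fourierIntegral_convergent_iff (-x)).2 U.integrable).const_mul (gnC d α : ℂ)
    · simpa using (Real.fourierIntegral_convergent_iff (-x)).2 hLi
  have hsub : {x | lam < ‖𝓕⁻ (U : EuclideanSpace ℝ (Fin d) → ℂ) x‖} ⊆
      {x | ENNReal.ofReal (gnC d α * lam / 2) ≤ ‖𝓕⁻ Hf x‖ₑ} := by
    intro x hx
    simp only [Set.mem_setOf_eq] at hx ⊢
    rw [← ofReal_norm_eq_enorm]
    apply ENNReal.ofReal_le_ofReal
    rw [hF]
    have h1 := norm_sub_norm_le ((gnC d α : ℂ) * 𝓕⁻ (U : EuclideanSpace ℝ (Fin d) → ℂ) x) (𝓕⁻ Lf x)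
    have h2 := (gn_low hα V V.integrable B hB ht x).trans htl
    rw [norm_mul, Complex.norm_real, Real.norm_of_nonneg hC.le] at h1
    have h3 := mul_le_mul_of_nonneg_left hx.le hC.le
    simp only [hLf] at h1 ⊢
    linarith
  have hcont : Continuous (𝓕⁻ Hf) :=
    VectorFourier.fourierIntegral_continuous Real.continuous_fourierChar
      (by simpa using! continuous_inner.neg) hHi
  have hmark := mul_meas_ge_le_pow_eLpNorm' (p := 2) volume (by norm_num) (by norm_num)
    (hcont.aestronglyMeasurable (μ := volume)) (ENNReal.ofReal (gnC d α * lam / 2))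
  rw [gn_plancherel Hf hHi hH2] at hmark
  have hnorm : eLpNorm Hf 2 volume ^ (2 : ℝ≥0∞).toReal
      = ∫⁻ ξ, ENNReal.ofReal (gnH d α t (1 + ‖ξ‖ ^ 2) ^ 2 * ‖V ξ‖ ^ 2) := by
    rw [eLpNorm_eq_lintegral_rpow_enorm_toReal (by norm_num) (by norm_num)]
    rw [← ENNReal.rpow_mul]
    norm_num
    congr 1
    ext ξ
    rw [← ofReal_norm_eq_enorm, ← ENNReal.ofReal_pow (norm_nonneg _)]
    congr 1
    simp only [hHf]
    rw [norm_mul, Complex.norm_real, mul_pow, Real.norm_eq_abs, sq_abs]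
  rw [hnorm] at hmark
  have hpos : 0 < gnC d α * lam / 2 := by positivity
  rw [ENNReal.toReal_ofNat, ENNReal.ofReal_rpow_of_pos hpos] at hmark
  calc _ ≤ _ := measure_mono hsub
    _ = ENNReal.ofReal ((gnC d α * lam / 2) ^ (-2 : ℝ)) * (ENNReal.ofReal ((gnC d α * lam / 2) ^ (2 : ℝ))
        * volume {x | ENNReal.ofReal (gnC d α * lam / 2) ≤ ‖𝓕⁻ Hf x‖ₑ}) := by
      rw [← mul_assoc, ← ENNReal.ofReal_mul (by positivity), ← rpow_add hpos]
      norm_num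
    _ ≤ _ := by gcongr


theorem gn_sq {x : ℝ} (hx : 0 < x) (a : ℝ) : (x ^ a) ^ 2 = x ^ (2 * a) := by
  rw [← rpow_natCast, ← rpow_mul hx.le]
  congr 1
  push_cast
  ring

noncomputable def gnPhi (q l0 a b l : ℝ) : ℝ :=
  if l ≤ l0 then a * l ^ (q - 3) else b * l ^ (-3 * q - 1)

theorem gnPhi_lintegral {q : ℝ} (hq : 2 < q) {l0 a b : ℝ} (h0 : 0 < l0) (ha : 0 ≤ a) (hb : 0 ≤ b) :
    ∫⁻ l in Set.Ioi (0:ℝ), ENNReal.ofReal (gnPhi q l0 a b l) ≤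
      ENNReal.ofReal (a * (l0 ^ (q - 2) / (q - 2)) + b * (l0 ^ (-3 * q) / (3 * q))) := by
  have hU : Set.Ioi (0:ℝ) = Set.Ioc 0 l0 ∪ Set.Ioi l0 := (Set.Ioc_union_Ioi_eq_Ioi h0.le).symm
  rw [hU, ENNReal.ofReal_add (by have := sub_pos.2 hq; positivity) (by positivity)]
  refine (lintegral_union_le _ _ _).trans (add_le_add ?_ ?_)
  · have h1 : ∫⁻ l in Set.Ioc 0 l0, ENNReal.ofReal (gnPhi q l0 a b l) =
        ∫⁻ l in Set.Ioc 0 l0, ENNReal.ofReal (a * l ^ (q - 3)) := by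
      apply setLIntegral_congr_fun measurableSet_Ioc
      intro l hl
      simp only [gnPhi, if_pos hl.2]
    have hint : IntegrableOn (fun l : ℝ => a * l ^ (q - 3)) (Set.Ioc 0 l0) := by
      have := (intervalIntegral.intervalIntegrable_rpow' (a := 0) (b := l0) (r := q - 3) (by linarith)).const_mul a
      rwa [intervalIntegrable_iff_integrableOn_Ioc_of_le h0.le] at this
    rw [h1, ← ofReal_integral_eq_lintegral_ofReal hint]
    · apply ENNReal.ofReal_le_ofReal
      rw [integral_const_mul, ← intervalIntegral.integral_of_le h0.le, integral_rpow (Or.inl (by linarith)),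
        zero_rpow (by linarith)]
      rw [show q - 3 + 1 = q - 2 by ring, sub_zero]
    · filter_upwards [self_mem_ae_restrict measurableSet_Ioc] with l hl
      have := hl.1
      simp only [Pi.zero_apply]
      positivity
  · have h1 : ∫⁻ l in Set.Ioi l0, ENNReal.ofReal (gnPhi q l0 a b l) =
        ∫⁻ l in Set.Ioi l0, ENNReal.ofReal (b * l ^ (-3 * q - 1)) := by
      apply setLIntegral_congr_fun measurableSet_Ioi
      intro l hl
      simp only [gnPhi, if_neg (not_le.2 (show l0 < l from hl))]
    have hint : IntegrableOn (fun l : ℝ => b * l ^ (-3 * q - 1)) (Set.Ioi l0) :=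
      (integrableOn_Ioi_rpow_of_lt (by linarith) h0).const_mul b
    rw [h1, ← ofReal_integral_eq_lintegral_ofReal hint]
    · apply ENNReal.ofReal_le_ofReal
      rw [integral_const_mul, integral_Ioi_rpow_of_lt (by linarith) h0]
      rw [show -3 * q - 1 + 1 = -3 * q by ring]
      apply le_of_eq
      have : q ≠ 0 := by linarith
      field_simp
    · filter_upwards [self_mem_ae_restrict measurableSet_Ioi] with l hl
      have : 0 < l := h0.trans hl
      simp only [Pi.zero_apply]
      positivity

noncomputable def gnK (d : ℕ) (α q : ℝ) : ℝ :=
  4 / (q - 2) + 4 / (gnC d α ^ 2 * (d - α) ^ 2 * (3 * q))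

theorem gnPhi_lintegral' {d : ℕ} {α q : ℝ} (hα : 0 < α) (hαd : α < d) (hq : 2 < q)
    (hαq : (d:ℝ) = 2 * q * α) {ρ x : ℝ} (hρ : 0 < ρ) (hx : 0 < x) :
    ∫⁻ l in Set.Ioi (0:ℝ), ENNReal.ofReal (gnPhi q (x ^ α / ρ) (4 * x ^ (2 * α))
        (4 / (gnC d α ^ 2 * (d - α) ^ 2) * x ^ (2 * (d:ℝ)) * ρ ^ (-(4 * q - 2))) l) ≤
      ENNReal.ofReal (gnK d α q * ρ ^ (2 - q) * x ^ ((d:ℝ) / 2)) := by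
  have hC := gnC_pos d hα hαd
  refine (gnPhi_lintegral hq (by positivity) (by positivity) (by positivity)).trans ?_
  apply ENNReal.ofReal_le_ofReal
  apply le_of_eq
  have e1 : x ^ (2 * α) * (x ^ α / ρ) ^ (q - 2) = ρ ^ (2 - q) * x ^ ((d:ℝ) / 2) := by
    rw [div_rpow (by positivity) hρ.le, ← rpow_mul hx.le, div_eq_mul_inv, ← rpow_neg hρ.le, ← mul_assoc,
      ← rpow_add hx, mul_comm]
    congr 2
    · ring
    · rw [hαq]; ring
  have e2 : x ^ (2 * (d:ℝ)) * ρ ^ (-(4 * q - 2)) * (x ^ α / ρ) ^ (-3 * q) = ρ ^ (2 - q) * x ^ ((d:ℝ) / 2) := by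
    rw [div_rpow (by positivity) hρ.le, ← rpow_mul hx.le, div_eq_mul_inv, ← rpow_neg hρ.le,
      show ∀ a b c e : ℝ, a * b * (c * e) = (b * e) * (a * c) by intros; ring,
      ← rpow_add hx, ← rpow_add hρ]
    congr 2
    · ring
    · rw [hαq]; ring
  unfold gnK
  rw [show 4 * x ^ (2 * α) * ((x ^ α / ρ) ^ (q - 2) / (q - 2)) =
    4 / (q - 2) * (x ^ (2 * α) * (x ^ α / ρ) ^ (q - 2)) by ring,
    show 4 / (gnC d α ^ 2 * (d - α) ^ 2) * x ^ (2 * (d:ℝ)) * ρ ^ (-(4 * q - 2)) * ((x ^ α / ρ) ^ (-3 * q) / (3 * q))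
     = 4 / (gnC d α ^ 2 * (d - α) ^ 2 * (3 * q)) * (x ^ (2 * (d:ℝ)) * ρ ^ (-(4 * q - 2)) * (x ^ α / ρ) ^ (-3 * q)) by
      rw [← div_div 4 _ (3*q)]; ring, e1, e2]
  ring

theorem gnH_phi {d : ℕ} {α q : ℝ} (hα : 0 < α) (hαd : α < d) (hq : 2 < q)
    (hαq : (d:ℝ) = 2 * q * α) {ρ x l : ℝ} (hρ : 0 < ρ) (hx : 0 < x) (hl : 0 < l) :
    (gnC d α * l / 2) ^ (-2:ℝ) * gnH d α ((ρ * l) ^ (-1 / α)) x ^ 2 * l ^ (q - 1) ≤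
      gnPhi q (x ^ α / ρ) (4 * x ^ (2 * α))
        (4 / (gnC d α ^ 2 * (d - α) ^ 2) * x ^ (2 * (d:ℝ)) * ρ ^ (-(4 * q - 2))) l := by
  have hC := gnC_pos d hα hαd
  have ht : 0 < (ρ * l) ^ (-1 / α) := by positivity
  have hH0 := gnH_nonneg d (α := α) (t := (ρ * l) ^ (-1 / α)) hx
  have hda : 0 < (d:ℝ) - α := by linarith
  have e0 : (gnC d α * l / 2) ^ (-2:ℝ) = 4 / gnC d α ^ 2 * l ^ (-2:ℝ) := by
    rw [rpow_neg (by positivity), rpow_neg hl.le, rpow_two, rpow_two]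
    field_simp
    norm_num
  unfold gnPhi
  rw [e0]
  split_ifs with h
  · have := gnH_le d hα hαd hx ht
    calc _ ≤ 4 / gnC d α ^ 2 * l ^ (-2:ℝ) * (gnC d α * x ^ α) ^ 2 * l ^ (q - 1) := by gcongr
      _ = 4 * (x ^ α) ^ 2 * (l ^ (-2:ℝ) * l ^ (q - 1)) := by field_simp
      _ = _ := by
        rw [← rpow_add hl, gn_sq hx]
        congr 2
        ring
  · have := gnH_le' d hαd hx ht
    calc _ ≤ 4 / gnC d α ^ 2 * l ^ (-2:ℝ) * (x ^ d * (((ρ * l) ^ (-1 / α)) ^ ((d:ℝ) - α) / (d - α))) ^ 2 * l ^ (q - 1) := by gcongr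
      _ = 4 / gnC d α ^ 2 * l ^ (-2:ℝ) * (x ^ (d:ℝ) * ((ρ ^ (-(2 * q - 1)) * l ^ (-(2*q-1))) / (d - α))) ^ 2 * l ^ (q - 1) := by
        rw [← rpow_mul (by positivity), rpow_natCast, ← mul_rpow hρ.le hl.le]
        congr 6
        rw [hαq]; field_simp
        try ring
      _ = 4 / (gnC d α ^ 2 * (d - α) ^ 2) * (x ^ (d:ℝ)) ^ 2 * (ρ ^ (-(2 * q - 1))) ^ 2 * (l ^ (-2:ℝ) * l ^ (q - 1) * (l ^ (-(2*q-1))) ^ 2) := by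
        field_simp
      _ = _ := by
        rw [gn_sq hx, gn_sq hρ, gn_sq hl, ← rpow_add hl, ← rpow_add hl,
          show 2 * -(2 * q - 1) = -(4 * q - 2) by ring,
          show -2 + (q - 1) + -(4 * q - 2) = -3 * q - 1 by ring]

theorem gn_strong {d : ℕ} {α q : ℝ} (hα : 0 < α) (hαd : α < d) (hq : 2 < q)
    (hαq : (d:ℝ) = 2 * q * α)
    (V U : SchwartzMap (EuclideanSpace ℝ (Fin d)) ℂ)
    (hUV : ∀ ξ, U ξ = (((1 + ‖ξ‖ ^ 2) ^ α : ℝ) : ℂ) * V ξ)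
    (B : ℝ) (hB0 : 0 < B) (hB : ∀ s : ℝ, 0 < s → ∀ x : EuclideanSpace ℝ (Fin d),
      ‖𝓕⁻ (fun ξ => ((gnG d (s * (1 + ‖ξ‖ ^ 2)) : ℝ) : ℂ) * V ξ) x‖ ≤ B)
    {u : EuclideanSpace ℝ (Fin d) → ℂ} (huc : Continuous u)
    (hu : u = 𝓕⁻ (U : EuclideanSpace ℝ (Fin d) → ℂ)) :
    ∫⁻ x, ENNReal.ofReal (‖u x‖ ^ q) ≤
      ENNReal.ofReal (q * (gnK d α q * (α * gnC d α / (2 * B)) ^ (2 - q))) *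
        ∫⁻ ξ, ENNReal.ofReal ((1 + ‖ξ‖ ^ 2) ^ ((d:ℝ)/2) * ‖V ξ‖ ^ 2) := by
  have hC := gnC_pos d hα hαd
  set ρ := α * gnC d α / (2 * B) with hρd
  have hρ : 0 < ρ := by positivity
  have hK : 0 ≤ gnK d α q := by
    have := sub_pos.2 hq
    unfold gnK; positivity
  rw [lintegral_rpow_eq_lintegral_meas_lt_mul volume (Filter.Eventually.of_forall fun x => norm_nonneg _)
    (huc.norm.measurable.aemeasurable) (by linarith), ENNReal.ofReal_mul (by linarith), mul_assoc]
  gcongr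
  set P : ℝ → EuclideanSpace ℝ (Fin d) → ℝ := fun l ξ =>
    gnPhi q ((1 + ‖ξ‖ ^ 2) ^ α / ρ) (4 * (1 + ‖ξ‖ ^ 2) ^ (2 * α))
        (4 / (gnC d α ^ 2 * (d - α) ^ 2) * (1 + ‖ξ‖ ^ 2) ^ (2 * (d:ℝ)) * ρ ^ (-(4 * q - 2))) l with hP
  have hstep : ∀ l ∈ Set.Ioi (0:ℝ), volume {x | l < ‖u x‖} * ENNReal.ofReal (l ^ (q - 1)) ≤
      ∫⁻ ξ, ENNReal.ofReal (P l ξ) * ENNReal.ofReal (‖V ξ‖ ^ 2) := by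
    intro l hl
    have hl : 0 < l := hl
    have ht : 0 < (ρ * l) ^ (-1 / α) := by positivity
    have hw := gn_weak hα hαd V U hUV B hB ht hl (by
      rw [← rpow_mul (by positivity), show -1 / α * -α = 1 by field_simp, rpow_one, hρd]
      apply le_of_eq
      field_simp)
    rw [← hu] at hw
    calc _ ≤ ENNReal.ofReal ((gnC d α * l / 2) ^ (-2 : ℝ)) *
        (∫⁻ ξ, ENNReal.ofReal (gnH d α ((ρ * l) ^ (-1 / α)) (1 + ‖ξ‖ ^ 2) ^ 2 * ‖V ξ‖ ^ 2)) * ENNReal.ofReal (l ^ (q - 1)) := by gcongr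
      _ = ∫⁻ ξ, ENNReal.ofReal ((gnC d α * l / 2) ^ (-2 : ℝ)) *
         ENNReal.ofReal (gnH d α ((ρ * l) ^ (-1 / α)) (1 + ‖ξ‖ ^ 2) ^ 2 * ‖V ξ‖ ^ 2) * ENNReal.ofReal (l ^ (q - 1)) := by
        rw [lintegral_mul_const' _ _ ENNReal.ofReal_ne_top, lintegral_const_mul' _ _ ENNReal.ofReal_ne_top]
      _ ≤ _ := by
        apply lintegral_mono
        intro ξ
        simp only
        have := gnH_phi hα hαd hq hαq hρ (x := 1 + ‖ξ‖ ^ 2) (by positivity) hl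
        rw [← ENNReal.ofReal_mul (by positivity), ← ENNReal.ofReal_mul (by positivity), ← ENNReal.ofReal_mul' (by positivity)]
        apply ENNReal.ofReal_le_ofReal
        calc _ = (gnC d α * l / 2) ^ (-2:ℝ) * gnH d α ((ρ * l) ^ (-1 / α)) (1 + ‖ξ‖ ^ 2) ^ 2 * l ^ (q - 1) * ‖V ξ‖ ^ 2 := by ring
          _ ≤ _ := by
            apply mul_le_mul_of_nonneg_right this (by positivity)
  have hmeas : Measurable (Function.uncurry P) := by
    have hn : Measurable (fun p : ℝ × EuclideanSpace ℝ (Fin d) => 1 + ‖p.2‖ ^ 2) := by fun_prop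
    simp only [hP, gnPhi, Function.uncurry_def]
    apply Measurable.ite
    · exact measurableSet_le measurable_fst ((hn.pow_const _).div_const _)
    · exact ((hn.pow_const _).const_mul _).mul (measurable_fst.pow_const _)
    · exact (((hn.pow_const _).const_mul _).mul_const _).mul (measurable_fst.pow_const _)
  have hV : Measurable (fun ξ => ENNReal.ofReal (‖V ξ‖ ^ 2)) := by
    have := V.continuous
    fun_prop
  calc _ ≤ ∫⁻ l in Set.Ioi (0:ℝ), ∫⁻ ξ, ENNReal.ofReal (P l ξ) * ENNReal.ofReal (‖V ξ‖ ^ 2) :=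
        setLIntegral_mono' measurableSet_Ioi hstep
    _ = ∫⁻ ξ, ∫⁻ l in Set.Ioi (0:ℝ), ENNReal.ofReal (P l ξ) * ENNReal.ofReal (‖V ξ‖ ^ 2) := by
        apply lintegral_lintegral_swap
        apply Measurable.aemeasurable
        exact hmeas.ennreal_ofReal.mul (hV.comp measurable_snd)
    _ ≤ ∫⁻ ξ, ENNReal.ofReal (gnK d α q * ρ ^ (2 - q)) * ENNReal.ofReal ((1 + ‖ξ‖ ^ 2) ^ ((d:ℝ)/2) * ‖V ξ‖ ^ 2) := by
        apply lintegral_mono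
        intro ξ
        simp only
        rw [lintegral_mul_const' _ _ ENNReal.ofReal_ne_top,
          ENNReal.ofReal_mul (p := (1 + ‖ξ‖ ^ 2) ^ ((d:ℝ)/2)) (by positivity), ← mul_assoc,
          ← ENNReal.ofReal_mul (by positivity)]
        gcongr
        exact gnPhi_lintegral' hα hαd hq hαq hρ (by positivity)
    _ = _ := by rw [lintegral_const_mul' _ _ ENNReal.ofReal_ne_top]


theorem gn_mult {d : ℕ} (r : ℝ) (U : SchwartzMap (EuclideanSpace ℝ (Fin d)) ℂ) :
    ∃ W : SchwartzMap (EuclideanSpace ℝ (Fin d)) ℂ,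
      ∀ ξ, W ξ = (((1 + ‖ξ‖ ^ 2) ^ r : ℝ) : ℂ) * U ξ := by
  refine ⟨SchwartzMap.smulLeftCLM ℂ (fun ξ : EuclideanSpace ℝ (Fin d) => (1 + ‖ξ‖ ^ 2) ^ r) U, fun ξ => ?_⟩
  rw [SchwartzMap.smulLeftCLM_apply_apply (Function.hasTemperateGrowth_one_add_norm_sq_rpow _ r)]
  simp

theorem gn_dual {d : ℕ} (v f : SchwartzMap (EuclideanSpace ℝ (Fin d)) ℂ)
    (h : ∀ ξ, 𝓕 f ξ = (((1 + ‖ξ‖ ^ 2) ^ ((d:ℝ)/2) : ℝ) : ℂ) * 𝓕 v ξ) (M : ℝ) (hM : ∀ x, ‖v x‖ ≤ M) :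
    ∫⁻ ξ, ENNReal.ofReal ((1 + ‖ξ‖ ^ 2) ^ ((d:ℝ)/2) * ‖𝓕 v ξ‖ ^ 2) ≤
      ENNReal.ofReal (M * ∫ x, ‖f x‖) := by
  have e : ∀ ξ, inner ℂ (𝓕 v ξ) (𝓕 f ξ) = (((1 + ‖ξ‖ ^ 2) ^ ((d:ℝ)/2) * ‖𝓕 v ξ‖ ^ 2 : ℝ) : ℂ) := by
    intro ξ
    rw [h]
    simp only [RCLike.inner_apply]
    rw [mul_assoc, RCLike.mul_conj]
    push_cast
    rfl
  have hn : ∀ ξ, (1 + ‖ξ‖ ^ 2) ^ ((d:ℝ)/2) * ‖𝓕 v ξ‖ ^ 2 = ‖𝓕 v ξ‖ * ‖𝓕 f ξ‖ := by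
    intro ξ
    rw [h, norm_mul, Complex.norm_real, norm_of_nonneg (by positivity)]
    ring
  have hint : Integrable (fun ξ => (1 + ‖ξ‖ ^ 2) ^ ((d:ℝ)/2) * ‖𝓕 v ξ‖ ^ 2) := by
    simp_rw [hn]
    obtain ⟨C, hC⟩ : ∃ C, ∀ ξ, ‖𝓕 v ξ‖ ≤ C := ⟨_, fun ξ => norm_fourier_apply_le_toLp_one v ξ⟩
    refine (𝓕 f).integrable.norm.bdd_mul (c := C) (𝓕 v).continuous.norm.aestronglyMeasurable ?_
    filter_upwards with ξ
    simpa using hC ξ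
  rw [← ofReal_integral_eq_lintegral_ofReal hint (Filter.Eventually.of_forall fun ξ => by
    simp only [Pi.zero_apply]; positivity)]
  apply ENNReal.ofReal_le_ofReal
  have hp := integral_inner_fourier_fourier v f
  simp_rw [e] at hp
  rw [integral_complex_ofReal] at hp
  calc _ ≤ ‖((∫ ξ, (1 + ‖ξ‖ ^ 2) ^ ((d:ℝ)/2) * ‖𝓕 v ξ‖ ^ 2 : ℝ) : ℂ)‖ := by
        rw [Complex.norm_real]; exact le_norm_self _
    _ = ‖∫ x, inner ℂ (v x) (f x)‖ := by rw [hp]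
    _ ≤ ∫ x, M * ‖f x‖ := by
        apply norm_integral_le_of_norm_le (f.integrable.norm.const_mul M)
        filter_upwards with x
        exact (norm_inner_le_norm _ _).trans (mul_le_mul_of_nonneg_right (hM x) (norm_nonneg _))
    _ = _ := integral_const_mul _ _

/-- The core estimate, in terms of real numbers. -/
theorem gn_core (d : ℕ) (hd : 1 ≤ d) (q : ℝ) (hq : 2 ≤ q) (κ : ℝ)
    (hκ1 : 1 / q ≤ κ) (hκ2 : κ ≤ 1 - 1 / q) :
    ∃ K : ℝ, 0 < K ∧ ∀ u v f : SchwartzMap (EuclideanSpace ℝ (Fin d)) ℂ,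
      (∀ ξ, 𝓕 f ξ = (((1 + ‖ξ‖ ^ 2) ^ ((d:ℝ)/2) : ℝ) : ℂ) * 𝓕 v ξ) →
      (∀ ξ, 𝓕 u ξ = (((1 + ‖ξ‖ ^ 2) ^ ((d:ℝ)/(2*q)) : ℝ) : ℂ) * 𝓕 v ξ) →
      ∀ M : ℝ, 0 < M → (∀ x, ‖v x‖ ≤ M) → 0 < ∫ x, ‖f x‖ →
      ∫⁻ x, ENNReal.ofReal (‖u x‖ ^ q) ≤ ENNReal.ofReal (K * M ^ (κ * q) * (∫ x, ‖f x‖) ^ ((1 - κ) * q)) := by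
  have hd' : (0:ℝ) < d := by exact_mod_cast hd
  have hq0 : 0 < q := by linarith
  set α := (d:ℝ)/(2*q) with hαdef
  have hα : 0 < α := by positivity
  have hαd : α < d := by
    rw [hαdef, div_lt_iff₀ (by positivity)]; nlinarith
  have hαq : (d:ℝ) = 2 * q * α := by rw [hαdef]; field_simp
  rcases hq.eq_or_lt with h2 | h2
  · refine ⟨1, one_pos, ?_⟩
    intro u v f hf hu M hM hv hN
    subst h2
    have hk : κ = 1/2 := by linarith
    have := gn_dual v f hf M hv
    have e1 : κ * 2 = 1 := by rw [hk]; norm_num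
    have e2 : (1 - κ) * 2 = 1 := by rw [hk]; norm_num
    rw [e1, e2, rpow_one, rpow_one, one_mul]
    refine le_trans (le_of_eq ?_) this
    have hint : ∀ g : SchwartzMap (EuclideanSpace ℝ (Fin d)) ℂ, Integrable (fun x => ‖g x‖ ^ 2) := fun g =>
      (memLp_two_iff_integrable_sq_norm g.continuous.aestronglyMeasurable).1 (g.memLp 2 volume)
    have e3 : ∀ ξ, (1 + ‖ξ‖ ^ 2) ^ ((d:ℝ)/2) * ‖𝓕 v ξ‖ ^ 2 = ‖𝓕 u ξ‖ ^ 2 := by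
      intro ξ
      rw [hu, norm_mul, Complex.norm_real, norm_of_nonneg (by positivity), mul_pow, gn_sq (by positivity)]
      congr 2
      rw [hαdef]; ring
    simp_rw [e3, rpow_two]
    rw [← ofReal_integral_eq_lintegral_ofReal (hint u) (Filter.Eventually.of_forall fun ξ => by
      simp only [Pi.zero_apply]; positivity), ← ofReal_integral_eq_lintegral_ofReal (hint (𝓕 u)) (Filter.Eventually.of_forall fun ξ => by
      simp only [Pi.zero_apply]; positivity), integral_norm_sq_fourier]
  · set A : ℝ := max (2 ^ d) (π ^ ((d:ℝ)/2)) with hA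
    have hA0 : 0 < A := lt_max_of_lt_left (by positivity)
    have hC := gnC_pos d hα hαd
    have hK : 0 < gnK d α q := by
      have := sub_pos.2 h2
      have := sub_pos.2 hαd
      unfold gnK; positivity
    set θ := (κ * q - 1) / (q - 2) with hθ
    have hq2 : 0 < q - 2 := by linarith
    have hκq1 : 1 ≤ κ * q := by rwa [div_le_iff₀ hq0] at hκ1
    have hκq2 : κ * q ≤ q - 1 := by
      have := mul_le_mul_of_nonneg_right hκ2 hq0.le
      rwa [sub_mul, one_mul, one_div_mul_cancel hq0.ne'] at this
    have hθ0 : 0 ≤ θ := div_nonneg (by linarith) hq2.le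
    have hθ1 : θ ≤ 1 := by rw [hθ, div_le_one hq2]; linarith
    have hθe : θ * (q - 2) = κ * q - 1 := by rw [hθ]; field_simp
    refine ⟨q * gnK d α q * (α * gnC d α / (2 * A)) ^ (2 - q), by positivity, ?_⟩
    intro u v f hf hu M hM hv hN
    set N := ∫ x, ‖f x‖ with hNd
    have hiv : 𝓕⁻ (⇑(𝓕 v : SchwartzMap (EuclideanSpace ℝ (Fin d)) ℂ)) = ⇑v := by
      rw [← fourierInv_coe]; simp
    have hiu : 𝓕⁻ (⇑(𝓕 u : SchwartzMap (EuclideanSpace ℝ (Fin d)) ℂ)) = ⇑u := by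
      rw [← fourierInv_coe]; simp
    have hmain := gn_strong hα hαd h2 hαq (𝓕 v) (𝓕 u) hu (A * (M ^ θ * N ^ (1 - θ))) (by positivity) (by
      intro s hs x
      have b1 := gn_bound_sup s hs M (⇑(𝓕 v : SchwartzMap (EuclideanSpace ℝ (Fin d)) ℂ)) (SchwartzMap.integrable _) (by rw [hiv]; exact hv) x
      have b2 := gn_bound_one s hs N (⇑(𝓕 v : SchwartzMap (EuclideanSpace ℝ (Fin d)) ℂ)) (fun ξ => by
        have := norm_fourier_apply_le_toLp_one f ξ
        rw [norm_toLp_one, hf, norm_mul, Complex.norm_real, norm_of_nonneg (by positivity)] at this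
        exact this) x
      set Z := ‖𝓕⁻ (fun ξ => ((gnG d (s * (1 + ‖ξ‖ ^ 2)) : ℝ) : ℂ) * 𝓕 v ξ) x‖
      have b1' : Z ≤ A * M := b1.trans (mul_le_mul_of_nonneg_right (le_max_left _ _) hM.le)
      have b2' : Z ≤ A * N := b2.trans (mul_le_mul_of_nonneg_right (le_max_right _ _) hN.le)
      have hZ : 0 ≤ Z := norm_nonneg _
      calc Z = Z ^ θ * Z ^ (1 - θ) := by
            rw [← rpow_add_of_nonneg hZ hθ0 (by linarith)]
            norm_num
        _ ≤ (A * M) ^ θ * (A * N) ^ (1 - θ) := by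
            apply mul_le_mul (rpow_le_rpow hZ b1' hθ0) (rpow_le_rpow hZ b2' (by linarith)) (by positivity) (by positivity)
        _ = A ^ θ * A ^ (1 - θ) * (M ^ θ * N ^ (1 - θ)) := by
            rw [mul_rpow hA0.le hM.le, mul_rpow hA0.le hN.le]; ring
        _ = _ := by
            rw [← rpow_add hA0]
            norm_num) (u := u) u.continuous hiu.symm
    refine hmain.trans ?_
    refine (mul_le_mul_right (gn_dual v f hf M hv) _).trans ?_
    rw [← ENNReal.ofReal_mul (by positivity)]
    apply ENNReal.ofReal_le_ofReal
    apply le_of_eq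
    have e1 : α * gnC d α / (2 * (A * (M ^ θ * N ^ (1 - θ)))) =
        α * gnC d α / (2 * A) * (M ^ (-θ) * N ^ (-(1 - θ))) := by
      rw [rpow_neg hM.le, rpow_neg hN.le]
      field_simp
    rw [e1, mul_rpow (by positivity) (by positivity), mul_rpow (by positivity) (by positivity), ← rpow_mul hM.le, ← rpow_mul hN.le]
    have e2 : M ^ (κ * q) = M ^ (-θ * (2 - q)) * M := by
      rw [← rpow_add_one hM.ne']; congr 1; linarith
    have e3 : N ^ ((1 - κ) * q) = N ^ (-(1 - θ) * (2 - q)) * N := by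
      rw [← rpow_add_one hN.ne']; congr 1; linarith
    rw [e2, e3]
    ring

theorem gn_sup {d : ℕ} (v : SchwartzMap (EuclideanSpace ℝ (Fin d)) ℂ) (x) :
    ‖v x‖ ≤ (eLpNorm v ⊤ volume).toReal := by
  have hfin : eLpNorm v ⊤ volume ≠ ⊤ := (v.memLp ⊤ volume).2.ne
  by_contra! hx
  have hopen : IsOpen {y | (eLpNorm v ⊤ volume).toReal < ‖v y‖} :=
    isOpen_lt continuous_const v.continuous.norm
  have hz : volume {y | (eLpNorm v ⊤ volume).toReal < ‖v y‖} = 0 := by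
    have h : ∀ᵐ y, ‖v y‖ ≤ (eLpNorm v ⊤ volume).toReal := by
      filter_upwards [ae_le_eLpNormEssSup (f := v) (μ := volume)] with y hy
      rw [← eLpNorm_exponent_top] at hy
      rw [← toReal_enorm]
      exact ENNReal.toReal_mono hfin hy
    rw [ae_iff] at h
    simpa using h
  have hz := (hopen.measure_eq_zero_iff volume).1 hz
  exact absurd (show x ∈ {y | (eLpNorm v ⊤ volume).toReal < ‖v y‖} from hx) (by rw [hz]; simp)

/-- Endpoint Gagliardo-Nirenberg inequality `‖u‖_q ≲ ‖⟨D⟩^{d/q'}u‖₁^{1-κ} ‖⟨D⟩^{-d/q}u‖_∞^{κ}`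
for `1/q ≤ κ ≤ 1/q'` (case `r₁ = 1, r₂ = ∞` in Proposition `prop:LargeFreqInterpolated`). -/
theorem gagliardo_nirenberg_endpoint_one_infty
    (d : ℕ) (hd : 1 ≤ d) (q : ℝ) (hq1 : 1 < q) (κ : ℝ)
    (hκ1 : 1 / q ≤ κ) (hκ2 : κ ≤ 1 - 1 / q) :
    ∃ C : ℝ, 0 < C ∧ ∀ u : SchwartzMap (EuclideanSpace ℝ (Fin d)) ℂ,
      eLpNorm (⇑u) (ENNReal.ofReal q) volume ≤ ENNReal.ofReal C *
        eLpNorm (fun x => 𝓕⁻ (fun ξ =>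
          (((1 + ‖ξ‖ ^ 2) ^ ((d * (1 - 1 / q)) / 2) : ℝ) : ℂ) * 𝓕 (⇑u) ξ) x) 1 volume ^ (1 - κ) *
        eLpNorm (fun x => 𝓕⁻ (fun ξ =>
          (((1 + ‖ξ‖ ^ 2) ^ ((-(d / q)) / 2) : ℝ) : ℂ) * 𝓕 (⇑u) ξ) x) ⊤ volume ^ κ := by
  have hq0 : 0 < q := by linarith
  have hq2 : 2 ≤ q := by
    have h : 1 / q ≤ 1 / 2 := by linarith
    exact (one_div_le_one_div hq0 two_pos).1 h
  have hκ0 : 0 ≤ κ := le_trans (by positivity) hκ1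
  have hκ01 : 0 ≤ 1 - κ := by
    have : 0 < 1 / q := by positivity
    linarith
  obtain ⟨K, hK, hmain⟩ := gn_core d hd q hq2 κ hκ1 hκ2
  refine ⟨K ^ (1 / q), by positivity, fun u => ?_⟩
  obtain ⟨V, hV⟩ := gn_mult (-((d:ℝ)/q)/2) (𝓕 u)
  obtain ⟨F, hF⟩ := gn_mult (((d:ℝ) * (1 - 1/q))/2) (𝓕 u)
  have hFV : ∀ ξ, F ξ = (((1 + ‖ξ‖ ^ 2) ^ ((d:ℝ)/2) : ℝ) : ℂ) * V ξ := by
    intro ξ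
    rw [hF, hV, ← mul_assoc, ← Complex.ofReal_mul, ← rpow_add (by positivity)]
    congr 4
    ring
  have hUV : ∀ ξ, 𝓕 u ξ = (((1 + ‖ξ‖ ^ 2) ^ ((d:ℝ)/(2*q)) : ℝ) : ℂ) * V ξ := by
    intro ξ
    rw [hV, ← mul_assoc, ← Complex.ofReal_mul, ← rpow_add (by positivity),
      show (d:ℝ)/(2*q) + -((d:ℝ)/q)/2 = 0 by field_simp; ring]
    simp
  set v : SchwartzMap (EuclideanSpace ℝ (Fin d)) ℂ := 𝓕⁻ V with hv
  set f : SchwartzMap (EuclideanSpace ℝ (Fin d)) ℂ := 𝓕⁻ F with hf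
  have hFv : 𝓕 v = V := by simp [hv]
  have hFf : 𝓕 f = F := by simp [hf]
  have e1 : (fun x => 𝓕⁻ (fun ξ : EuclideanSpace ℝ (Fin d) =>
          (((1 + ‖ξ‖ ^ 2) ^ ((d * (1 - 1 / q)) / 2) : ℝ) : ℂ) * 𝓕 (⇑u) ξ) x) = ⇑f := by
    rw [hf, fourierInv_coe]
    have : (⇑F) = fun ξ : EuclideanSpace ℝ (Fin d) =>
          (((1 + ‖ξ‖ ^ 2) ^ ((d * (1 - 1 / q)) / 2) : ℝ) : ℂ) * 𝓕 (⇑u) ξ := by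
      funext ξ
      rw [hF, fourier_coe]
    rw [this]
  have e2 : (fun x => 𝓕⁻ (fun ξ : EuclideanSpace ℝ (Fin d) =>
          (((1 + ‖ξ‖ ^ 2) ^ ((-(d / q)) / 2) : ℝ) : ℂ) * 𝓕 (⇑u) ξ) x) = ⇑v := by
    rw [hv, fourierInv_coe]
    have : (⇑V) = fun ξ : EuclideanSpace ℝ (Fin d) =>
          (((1 + ‖ξ‖ ^ 2) ^ ((-(d / q)) / 2) : ℝ) : ℂ) * 𝓕 (⇑u) ξ := by
      funext ξ
      rw [hV, fourier_coe]
    rw [this]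
  rw [e1, e2]
  have hzero : V = 0 → u = 0 := by
    intro h
    have h1 : 𝓕 u = 0 := by
      ext ξ
      rw [hUV, h]
      simp
    have h2 : 𝓕⁻ (𝓕 u) = u := by simp
    rw [← h2, h1]
    simp
  have hN : eLpNorm f 1 volume = ENNReal.ofReal (∫ x, ‖f x‖) := by
    rw [eLpNorm_one_eq_lintegral_enorm, ofReal_integral_norm_eq_lintegral_enorm f.integrable]
  have hfin : eLpNorm v ⊤ volume ≠ ⊤ := (v.memLp ⊤ volume).2.ne
  have hM : eLpNorm v ⊤ volume = ENNReal.ofReal (eLpNorm v ⊤ volume).toReal :=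
    (ENNReal.ofReal_toReal hfin).symm
  set N := ∫ x, ‖f x‖ with hNd
  set M := (eLpNorm v ⊤ volume).toReal with hMd
  have hsup : ∀ x, ‖v x‖ ≤ M := gn_sup v
  have hM0 : 0 ≤ M := ENNReal.toReal_nonneg
  have hN0 : 0 ≤ N := integral_nonneg fun x => norm_nonneg _
  rcases hM0.eq_or_lt with h | hM0
  · have : u = 0 := by
      apply hzero
      rw [← hFv]
      have : v = 0 := by
        ext x
        have := hsup x
        rw [← h] at this
        simpa using this
      rw [this]
      simp
    rw [this]
    simp
  rcases hN0.eq_or_lt with h | hN0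
  · have : u = 0 := by
      apply hzero
      ext ξ
      have h1 := norm_fourier_apply_le_toLp_one f ξ
      rw [norm_toLp_one, ← hNd, ← h, hFf, hFV] at h1
      have h2 := norm_le_zero_iff.1 h1
      rcases mul_eq_zero.1 h2 with h3 | h3
      · exfalso
        have : (0:ℝ) < (1 + ‖ξ‖ ^ 2) ^ ((d:ℝ)/2) := by positivity
        exact this.ne' (by exact_mod_cast h3)
      · simpa using h3
    rw [this]
    simp
  have hfinal := hmain u v f (by rw [hFf, hFv]; exact hFV) (by rw [hFv]; exact hUV) M hM0 hsup hN0
  rw [← hNd] at hfinal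
  rw [hN, hM, eLpNorm_eq_lintegral_rpow_enorm_toReal (by simpa using hq0) ENNReal.ofReal_ne_top,
    ENNReal.toReal_ofReal hq0.le]
  have e3 : ∀ x, ‖u x‖ₑ ^ q = ENNReal.ofReal (‖u x‖ ^ q) := by
    intro x
    rw [← ENNReal.ofReal_rpow_of_nonneg (norm_nonneg _) hq0.le, ofReal_norm]
  simp_rw [e3]
  calc _ ≤ (ENNReal.ofReal (K * M ^ (κ * q) * N ^ ((1 - κ) * q))) ^ (1 / q) :=
        ENNReal.rpow_le_rpow hfinal (by positivity)
    _ = ENNReal.ofReal (K ^ (1 / q) * N ^ (1 - κ) * M ^ κ) := by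
        rw [ENNReal.ofReal_rpow_of_pos (by positivity), mul_rpow (by positivity) (by positivity),
          mul_rpow (by positivity) (by positivity), ← rpow_mul hM0.le, ← rpow_mul hN0.le,
          mul_assoc κ, mul_assoc (1 - κ), mul_one_div_cancel hq0.ne', mul_one, mul_one]
        congr 1
        ring
    _ = _ := by
        rw [ENNReal.ofReal_mul (by positivity), ENNReal.ofReal_mul (by positivity),
          ENNReal.ofReal_rpow_of_pos hN0, ENNReal.ofReal_rpow_of_pos hM0]
end

section
/- Let d ∈ ℕ, let 1 < r₂ < q < ∞ and let κ satisfy r₂/q ≤ κ ≤ 1. Then there exists a constant C > 0 such that for every Schwartz function u : ℝ^d → ℂ one has ‖u‖_q ≤ C · ‖⟨D⟩^{d(1 − 1/q)}u‖_1^{1−κ} · ‖⟨D⟩^{d(1/r₂ − 1/q)}u‖_{r₂}^{κ}. -/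
open MeasureTheory Real SchwartzMap
open scoped FourierTransform ENNReal NNReal

namespace GN

/-- Heat kernel on `ℝ^d` (with the normalisation of the symbol `exp (-τ |ξ|²)`). -/
noncomputable def hk (d : ℕ) (τ : ℝ) (x y : EuclideanSpace ℝ (Fin d)) : ℝ :=
  (π / τ) ^ ((d : ℝ) / 2) * Real.exp (-(π ^ 2 / τ) * ‖x - y‖ ^ 2)

lemma lint_Ioc_rpow {a T : ℝ} (ha : 0 < a) (hT : 0 ≤ T) :
    ∫⁻ τ in Set.Ioc 0 T, ENNReal.ofReal (τ ^ (a - 1)) = ENNReal.ofReal (T ^ a / a) := by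
  have hint : IntegrableOn (fun τ : ℝ => τ ^ (a - 1)) (Set.Ioc 0 T) := by
    rw [← intervalIntegrable_iff_integrableOn_Ioc_of_le hT]
    exact intervalIntegral.intervalIntegrable_rpow' (by linarith)
  rw [← ofReal_integral_eq_lintegral_ofReal hint]
  · rw [← intervalIntegral.integral_of_le hT, integral_rpow (Or.inl (by linarith))]
    simp [Real.zero_rpow ha.ne']
  · filter_upwards [ae_restrict_mem measurableSet_Ioc] with τ hτ
    exact Real.rpow_nonneg hτ.1.le _

lemma lint_Ioi_rpow {e T : ℝ} (he : 0 < e) (hT : 0 < T) :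
    ∫⁻ τ in Set.Ioi T, ENNReal.ofReal (τ ^ (-e - 1)) = ENNReal.ofReal (T ^ (-e) / e) := by
  have hint : IntegrableOn (fun τ : ℝ => τ ^ (-e - 1)) (Set.Ioi T) :=
    integrableOn_Ioi_rpow_of_lt (by linarith) hT
  rw [← ofReal_integral_eq_lintegral_ofReal hint]
  · rw [integral_Ioi_rpow_of_lt (by linarith) hT]
    congr 1
    have : -e - 1 + 1 = -e := by ring
    rw [this, neg_div_neg_eq]
  · filter_upwards [ae_restrict_mem measurableSet_Ioi] with τ hτ
    exact Real.rpow_nonneg (hT.le.trans (le_of_lt hτ)) _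

lemma hk_nonneg (d : ℕ) {τ : ℝ} (hτ : 0 < τ) (x y : EuclideanSpace ℝ (Fin d)) :
    0 ≤ hk d τ x y := by unfold hk; positivity

lemma hk_le (d : ℕ) {τ : ℝ} (hτ : 0 < τ) (x y : EuclideanSpace ℝ (Fin d)) :
    hk d τ x y ≤ (π / τ) ^ ((d : ℝ) / 2) := by
  unfold hk
  apply mul_le_of_le_one_right (by positivity)
  rw [Real.exp_le_one_iff]
  have : 0 ≤ π ^ 2 / τ * ‖x - y‖ ^ 2 := by positivity
  linarith

lemma hk_comm (d : ℕ) (τ : ℝ) (x y : EuclideanSpace ℝ (Fin d)) :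
    hk d τ x y = hk d τ y x := by
  unfold hk; rw [norm_sub_rev]

lemma measurable_hk (d : ℕ) :
    Measurable (fun p : ℝ × EuclideanSpace ℝ (Fin d) × EuclideanSpace ℝ (Fin d) =>
      hk d p.1 p.2.1 p.2.2) := by
  unfold hk
  fun_prop

lemma lint_hk (d : ℕ) {τ : ℝ} (hτ : 0 < τ) (x : EuclideanSpace ℝ (Fin d)) :
    ∫⁻ y, ENNReal.ofReal (hk d τ x y) = 1 := by
  have hb : 0 < π ^ 2 / τ := by positivity
  have hint : Integrable (fun v : EuclideanSpace ℝ (Fin d) =>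
      Real.exp (-(π ^ 2 / τ) * ‖v‖ ^ 2)) := by
    have := (GaussianFourier.integrable_cexp_neg_mul_sq_norm_add (V := EuclideanSpace ℝ (Fin d))
      (b := ((π ^ 2 / τ : ℝ) : ℂ)) (by rw [Complex.ofReal_re]; exact hb) 0 0).norm
    refine this.congr (Filter.Eventually.of_forall fun v => ?_)
    simp only [Complex.norm_exp]
    norm_cast
    simp
  have h1 : ∫⁻ y, ENNReal.ofReal (hk d τ x y) = ∫⁻ y, ENNReal.ofReal (hk d τ 0 y) := by
    have := lintegral_sub_left_eq_self (μ := (volume : Measure (EuclideanSpace ℝ (Fin d))))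
      (fun y => ENNReal.ofReal (hk d τ 0 y)) x
    rw [← this]
    congr 1; ext y; congr 1; unfold hk; congr 4
    rw [zero_sub, norm_neg]
  rw [h1]
  have h2 : ∀ y, hk d τ 0 y = (π / τ) ^ ((d : ℝ) / 2) *
      Real.exp (-(π ^ 2 / τ) * ‖y‖ ^ 2) := by
    intro y; unfold hk; rw [zero_sub, norm_neg]
  simp_rw [h2]
  rw [← ofReal_integral_eq_lintegral_ofReal (hint.const_mul _)
    (Filter.Eventually.of_forall fun v => by positivity), integral_const_mul,
    GaussianFourier.integral_rexp_neg_mul_sq_norm hb]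
  rw [finrank_euclideanSpace_fin, ← Real.mul_rpow (by positivity) (by positivity)]
  have : π / τ * (π / (π ^ 2 / τ)) = 1 := by field_simp
  rw [this]; simp

lemma subord {d : ℕ} {a : ℝ} (ha : 0 < a) {G : EuclideanSpace ℝ (Fin d) → ℂ}
    (hG : Integrable G) :
    ‖∫ ξ, (((1 + ‖ξ‖ ^ 2) ^ (-a) : ℝ) : ℂ) * G ξ‖ₑ ≤ ENNReal.ofReal (1 / Real.Gamma a) *
      ∫⁻ τ in Set.Ioi (0 : ℝ), ENNReal.ofReal (τ ^ (a - 1)) *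
        ‖∫ ξ, ((Real.exp (-τ * ‖ξ‖ ^ 2) : ℝ) : ℂ) * G ξ‖ₑ := by
  have hΓ := Real.Gamma_pos_of_pos ha
  have h1 : ∀ ξ : EuclideanSpace ℝ (Fin d), (((1 + ‖ξ‖ ^ 2) ^ (-a) : ℝ) : ℂ) * G ξ =
      (1 / Real.Gamma a : ℝ) * ∫ τ in Set.Ioi (0 : ℝ),
        ((τ ^ (a - 1) * Real.exp (-((1 + ‖ξ‖ ^ 2) * τ)) : ℝ) : ℂ) * G ξ := by
    intro ξ
    have hp : 0 < 1 + ‖ξ‖ ^ 2 := by positivity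
    rw [integral_mul_const, integral_complex_ofReal,
      Real.integral_rpow_mul_exp_neg_mul_Ioi ha hp, ← mul_assoc, ← Complex.ofReal_mul]
    congr 2
    rw [one_div (1 + ‖ξ‖ ^ 2), Real.inv_rpow hp.le, Real.rpow_neg hp.le]
    field_simp
  have hτint : Integrable (fun τ : ℝ => ((τ ^ (a - 1) * Real.exp (-τ) : ℝ) : ℂ))
      (volume.restrict (Set.Ioi (0 : ℝ))) := by
    have h0 : Integrable (fun τ : ℝ => τ ^ (a - 1) * Real.exp (-τ))
        (volume.restrict (Set.Ioi (0 : ℝ))) := by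
      have := Real.GammaIntegral_convergent ha
      exact this.congr (Filter.Eventually.of_forall fun τ => mul_comm _ _)
    exact h0.ofReal
  have hint : Integrable (Function.uncurry fun (ξ : EuclideanSpace ℝ (Fin d)) (τ : ℝ) =>
      ((τ ^ (a - 1) * Real.exp (-((1 + ‖ξ‖ ^ 2) * τ)) : ℝ) : ℂ) * G ξ)
      (volume.prod (volume.restrict (Set.Ioi (0 : ℝ)))) := by
    have hdom := hG.mul_prod hτint
    refine hdom.mono ?_ ?_
    · apply AEStronglyMeasurable.mul
      · apply Measurable.aestronglyMeasurable
        fun_prop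
      · exact hG.aestronglyMeasurable.comp_fst
    · have : ∀ᵐ p : EuclideanSpace ℝ (Fin d) × ℝ ∂(volume.prod (volume.restrict (Set.Ioi (0:ℝ)))),
          0 < p.2 := by
        have h0 : ∀ᵐ τ : ℝ ∂(volume.restrict (Set.Ioi (0:ℝ))), 0 < τ :=
          ae_restrict_mem measurableSet_Ioi
        exact Measure.quasiMeasurePreserving_snd.ae h0
      filter_upwards [this] with p hp
      simp only [Function.uncurry, norm_mul, Complex.norm_real, Real.norm_eq_abs]
      rw [mul_comm (‖G p.1‖)]
      gcongr
      nlinarith [mul_nonneg (sq_nonneg ‖p.1‖) hp.le]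
  simp_rw [h1]
  rw [integral_const_mul, integral_integral_swap hint, enorm_mul]
  gcongr
  · rw [← ofReal_norm, Complex.norm_real, Real.norm_of_nonneg (by positivity)]
  · refine (enorm_integral_le_lintegral_enorm _).trans ?_
    refine setLIntegral_mono' measurableSet_Ioi fun τ hτ => ?_
    have hτ' : (0 : ℝ) < τ := hτ
    have : ∀ ξ : EuclideanSpace ℝ (Fin d),
        ((τ ^ (a - 1) * Real.exp (-((1 + ‖ξ‖ ^ 2) * τ)) : ℝ) : ℂ) * G ξ =
        ((τ ^ (a - 1) * Real.exp (-τ) : ℝ) : ℂ) *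
          (((Real.exp (-τ * ‖ξ‖ ^ 2) : ℝ) : ℂ) * G ξ) := by
      intro ξ
      rw [← mul_assoc, ← Complex.ofReal_mul, mul_assoc (τ ^ (a - 1)), ← Real.exp_add]
      congr 5; ring
    simp_rw [this]
    rw [integral_const_mul, enorm_mul]
    gcongr
    rw [← ofReal_norm, Complex.norm_real, Real.norm_of_nonneg (by positivity)]
    apply ENNReal.ofReal_le_ofReal
    apply mul_le_of_le_one_right (by positivity)
    rw [Real.exp_le_one_iff]; linarith

/-- heat extension of `g`, written on the Fourier side -/
noncomputable def heat {d : ℕ} (g : EuclideanSpace ℝ (Fin d) → ℂ) (τ : ℝ)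
    (x : EuclideanSpace ℝ (Fin d)) : ℂ :=
  ∫ ξ, ((Real.exp (-τ * ‖ξ‖ ^ 2) : ℝ) : ℂ) *
    (Complex.exp (2 * π * Complex.I * (inner ℝ x ξ : ℝ)) * 𝓕 g ξ)

lemma heat_eq {d : ℕ} {g : EuclideanSpace ℝ (Fin d) → ℂ} (hg : Integrable g) {τ : ℝ} (hτ : 0 < τ)
    (x : EuclideanSpace ℝ (Fin d)) :
    heat g τ x = ∫ y, ((hk d τ x y : ℝ) : ℂ) * g y := by
  have hτ' : 0 < ((τ : ℝ) : ℂ).re := by simpa using hτ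
  have hφ := GaussianFourier.integrable_cexp_neg_mul_sq_norm_add (V := EuclideanSpace ℝ (Fin d))
      hτ' (2 * π * Complex.I) x
  have key : ∫ ξ, (𝓕 (fun v : EuclideanSpace ℝ (Fin d) =>
      Complex.exp (-(τ : ℂ) * ‖v‖ ^ 2 + 2 * π * Complex.I * (inner ℝ x v : ℝ))) ξ) * g ξ =
      ∫ v, Complex.exp (-(τ : ℂ) * ‖v‖ ^ 2 + 2 * π * Complex.I * (inner ℝ x v : ℝ)) * 𝓕 g v := by
    simpa using! VectorFourier.integral_bilin_fourierIntegral_eq_flip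
      (ContinuousLinearMap.mul ℂ ℂ) (L := innerₗ (EuclideanSpace ℝ (Fin d)))
      Real.continuous_fourierChar continuous_inner hφ hg
  unfold heat
  have e1 : ∀ ξ : EuclideanSpace ℝ (Fin d), ((Real.exp (-τ * ‖ξ‖ ^ 2) : ℝ) : ℂ) *
    (Complex.exp (2 * π * Complex.I * (inner ℝ x ξ : ℝ)) * 𝓕 g ξ) =
    Complex.exp (-(τ : ℂ) * ‖ξ‖ ^ 2 + 2 * π * Complex.I * (inner ℝ x ξ : ℝ)) * 𝓕 g ξ := by
    intro ξ
    rw [Complex.exp_add, ← mul_assoc]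
    push_cast
    rfl
  simp_rw [e1]
  rw [← key]
  congr 1; ext y
  congr 1
  rw [fourier_gaussian_innerProductSpace' hτ', finrank_euclideanSpace_fin]
  unfold hk
  rw [Complex.ofReal_mul, Complex.ofReal_cpow (by positivity)]
  push_cast
  congr 2
  ring

lemma heat_le {d : ℕ} {g : EuclideanSpace ℝ (Fin d) → ℂ} (hg : Integrable g) {τ : ℝ} (hτ : 0 < τ)
    (x : EuclideanSpace ℝ (Fin d)) :
    ‖heat g τ x‖ₑ ≤ ∫⁻ y, ENNReal.ofReal (hk d τ x y) * ‖g y‖ₑ := by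
  rw [heat_eq hg hτ]
  refine (enorm_integral_le_lintegral_enorm _).trans (le_of_eq ?_)
  congr 1; ext y
  rw [enorm_mul, ← ofReal_norm, Complex.norm_real, Real.norm_of_nonneg (hk_nonneg d hτ x y)]

lemma heat_le_one {d : ℕ} {g : EuclideanSpace ℝ (Fin d) → ℂ} (hg : Integrable g) {τ : ℝ}
    (hτ : 0 < τ) (x : EuclideanSpace ℝ (Fin d)) :
    ‖heat g τ x‖ₑ ≤ ENNReal.ofReal ((π / τ) ^ ((d : ℝ) / 2)) * ∫⁻ y, ‖g y‖ₑ := by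
  refine (heat_le hg hτ x).trans ?_
  rw [← lintegral_const_mul' _ _ ENNReal.ofReal_ne_top]
  refine lintegral_mono fun y => ?_
  gcongr
  exact hk_le d hτ x y

lemma heat_le_r {d : ℕ} {g : EuclideanSpace ℝ (Fin d) → ℂ} (hg : Integrable g) (hgc : Continuous g)
    {τ : ℝ} (hτ : 0 < τ) {r : ℝ} (hr : 1 < r) (x : EuclideanSpace ℝ (Fin d)) :
    ‖heat g τ x‖ₑ ≤ (ENNReal.ofReal ((π / τ) ^ ((d : ℝ) / 2)) * ∫⁻ y, ‖g y‖ₑ ^ r) ^ (1 / r) := by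
  refine (heat_le hg hτ x).trans ?_
  have hm : Measurable (fun y => ENNReal.ofReal (hk d τ x y)) := by
    have := (measurable_hk d).comp (f := fun y : EuclideanSpace ℝ (Fin d) => (τ, x, y)) (by fun_prop)
    exact this.ennreal_ofReal
  have hpq : r.HolderConjugate (r / (r - 1)) := Real.HolderConjugate.conjExponent hr
  have hgm : Measurable fun y => ‖g y‖ₑ := by fun_prop
  have hold := ENNReal.lintegral_mul_le_Lp_mul_Lq
    (volume : Measure (EuclideanSpace ℝ (Fin d))) hpq
    (f := fun y => ENNReal.ofReal (hk d τ x y) ^ (1 / r) * ‖g y‖ₑ)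
    (g := fun y => ENNReal.ofReal (hk d τ x y) ^ (1 / (r / (r - 1))))
    ((hm.pow_const _).mul hgm).aemeasurable (hm.pow_const _).aemeasurable
  have hr0 : 0 < r := by linarith
  have hr1 : 0 < r - 1 := by linarith
  have e1 : ∀ y, ((fun y => ENNReal.ofReal (hk d τ x y) ^ (1 / r) * ‖g y‖ₑ) *
    (fun y => ENNReal.ofReal (hk d τ x y) ^ (1 / (r / (r - 1))))) y =
      ENNReal.ofReal (hk d τ x y) * ‖g y‖ₑ := by
    intro y
    simp only [Pi.mul_apply]
    rw [mul_right_comm, ← ENNReal.rpow_add_of_nonneg _ _ (by positivity) (by positivity)]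
    have : 1 / r + 1 / (r / (r - 1)) = 1 := by field_simp; ring
    rw [this, ENNReal.rpow_one]
  simp_rw [e1] at hold
  refine hold.trans ?_
  have e2 : ∀ y, (ENNReal.ofReal (hk d τ x y) ^ (1 / (r / (r - 1)))) ^ (r / (r - 1)) =
      ENNReal.ofReal (hk d τ x y) := by
    intro y
    rw [← ENNReal.rpow_mul, one_div_mul_cancel (by positivity), ENNReal.rpow_one]
  simp_rw [e2]
  rw [lint_hk d hτ, ENNReal.one_rpow, mul_one]
  gcongr
  rw [← lintegral_const_mul' _ _ ENNReal.ofReal_ne_top]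
  refine lintegral_mono fun y => ?_
  simp only
  rw [ENNReal.mul_rpow_of_nonneg _ _ hr0.le, ← ENNReal.rpow_mul, one_div_mul_cancel hr0.ne',
    ENNReal.rpow_one]
  gcongr
  exact hk_le d hτ x y

lemma weak {d : ℕ} {a e A B T c lam : ℝ} (ha : 0 < a) (he : 0 < e) (hA : 0 < A) (hB : 0 < B)
    (hT : 0 < T) (hc : 0 < c) (hlam : 0 < lam)
    {U G : EuclideanSpace ℝ (Fin d) → ℝ} (hG : Measurable G)
    {P : ℝ → EuclideanSpace ℝ (Fin d) → ℝ≥0∞}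
    (hP1 : ∀ τ, 0 < τ → ∀ x, P τ x ≤ ∫⁻ y, ENNReal.ofReal (hk d τ x y) * ENNReal.ofReal (G y))
    (hP2 : ∀ τ, 0 < τ → ∀ x, P τ x ≤ ENNReal.ofReal (B * τ ^ (-(a + e))))
    (hU : ∀ x, ENNReal.ofReal (U x) ≤ ENNReal.ofReal A *
      ∫⁻ τ in Set.Ioi (0 : ℝ), ENNReal.ofReal (τ ^ (a - 1)) * P τ x)
    (h1 : A * (c * (T ^ a / a)) ≤ lam / 4) (h2 : A * (B * (T ^ (-e) / e)) ≤ lam / 4) :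
    volume {x | lam ≤ U x} ≤ ENNReal.ofReal (2 * A * (T ^ a / a) / lam) *
      ∫⁻ y, ENNReal.ofReal (G y - c) := by
  set V : EuclideanSpace ℝ (Fin d) → ℝ≥0∞ := fun x => ∫⁻ τ in Set.Ioc (0 : ℝ) T,
    ENNReal.ofReal (τ ^ (a - 1)) * ∫⁻ y, ENNReal.ofReal (hk d τ x y) * ENNReal.ofReal (G y - c)
    with hV
  have hkm : Measurable (fun p : (EuclideanSpace ℝ (Fin d) × ℝ) × EuclideanSpace ℝ (Fin d) =>
      ENNReal.ofReal (hk d p.1.2 p.1.1 p.2)) := by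
    have := (measurable_hk d).comp
      (f := fun p : (EuclideanSpace ℝ (Fin d) × ℝ) × EuclideanSpace ℝ (Fin d) =>
        (p.1.2, p.1.1, p.2)) (by fun_prop)
    exact this.ennreal_ofReal
  have hkm1 : ∀ τ x, Measurable (fun y => ENNReal.ofReal (hk d τ x y)) := fun τ x =>
    hkm.comp (f := fun y => ((x, τ), y)) (by fun_prop)
  have hkm2 : ∀ τ y, Measurable (fun x => ENNReal.ofReal (hk d τ x y)) := fun τ y =>
    hkm.comp (f := fun x => ((x, τ), y)) (by fun_prop)
  have hGc : Measurable fun y => ENNReal.ofReal (G y - c) := by fun_prop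
  have hinner : Measurable (fun p : EuclideanSpace ℝ (Fin d) × ℝ =>
      ENNReal.ofReal (p.2 ^ (a - 1)) *
        ∫⁻ y, ENNReal.ofReal (hk d p.2 p.1 y) * ENNReal.ofReal (G y - c)) := by
    apply Measurable.mul (by fun_prop)
    apply Measurable.lintegral_prod_right'
      (f := fun p : (EuclideanSpace ℝ (Fin d) × ℝ) × EuclideanSpace ℝ (Fin d) =>
        ENNReal.ofReal (hk d p.1.2 p.1.1 p.2) * ENNReal.ofReal (G p.2 - c))
    exact hkm.mul (hGc.comp measurable_snd)
  have hinner1 : ∀ x, Measurable (fun τ : ℝ =>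
      ENNReal.ofReal (τ ^ (a - 1)) *
        ∫⁻ y, ENNReal.ofReal (hk d τ x y) * ENNReal.ofReal (G y - c)) := fun x =>
    hinner.comp (f := fun τ => (x, τ)) (by fun_prop)
  have hVm : Measurable V := by
    apply Measurable.lintegral_prod_right' (ν := volume.restrict (Set.Ioc (0 : ℝ) T))
      (f := fun p : EuclideanSpace ℝ (Fin d) × ℝ =>
      ENNReal.ofReal (p.2 ^ (a - 1)) *
        ∫⁻ y, ENNReal.ofReal (hk d p.2 p.1 y) * ENNReal.ofReal (G y - c))
    exact hinner
  -- the total mass of V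
  have hVint : ∫⁻ x, V x = ENNReal.ofReal (T ^ a / a) * ∫⁻ y, ENNReal.ofReal (G y - c) := by
    simp only [hV]
    rw [lintegral_lintegral_swap hinner.aemeasurable]
    rw [← lint_Ioc_rpow ha hT.le, ← lintegral_mul_const _ (by fun_prop)]
    refine setLIntegral_congr_fun measurableSet_Ioc fun τ hτ => ?_
    rw [lintegral_const_mul' _ _ ENNReal.ofReal_ne_top]
    congr 1
    rw [lintegral_lintegral_swap]
    · refine lintegral_congr fun y => ?_
      rw [lintegral_mul_const _ (hkm2 τ y)]
      simp_rw [hk_comm d τ _ y]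
      rw [lint_hk d hτ.1, one_mul]
    · apply Measurable.aemeasurable
      refine Measurable.mul (f := fun p : EuclideanSpace ℝ (Fin d) × EuclideanSpace ℝ (Fin d) =>
        ENNReal.ofReal (hk d τ p.1 p.2)) (g := fun p => ENNReal.ofReal (G p.2 - c)) ?_ ?_
      · exact hkm.comp (f := fun p : EuclideanSpace ℝ (Fin d) × EuclideanSpace ℝ (Fin d) =>
          ((p.1, τ), p.2)) (by fun_prop)
      · exact hGc.comp measurable_snd
  -- pointwise bound
  have hpt : ∀ x, ENNReal.ofReal (U x) ≤
      ENNReal.ofReal (lam / 4) + ENNReal.ofReal (lam / 4) + ENNReal.ofReal A * V x := by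
    intro x
    refine (hU x).trans ?_
    have hsplit : Set.Ioi (0 : ℝ) = Set.Ioc 0 T ∪ Set.Ioi T := (Set.Ioc_union_Ioi_eq_Ioi hT.le).symm
    have hlow : ∫⁻ τ in Set.Ioc (0 : ℝ) T, ENNReal.ofReal (τ ^ (a - 1)) * P τ x ≤
        ENNReal.ofReal (c * (T ^ a / a)) + V x := by
      rw [ENNReal.ofReal_mul hc.le, ← lint_Ioc_rpow ha hT.le,
        ← lintegral_const_mul' _ _ ENNReal.ofReal_ne_top]
      simp only [hV]
      rw [← lintegral_add_right _ (hinner1 x)]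
      refine setLIntegral_mono' measurableSet_Ioc fun τ hτ => ?_
      rw [mul_comm (ENNReal.ofReal c), ← mul_add]
      gcongr
      refine (hP1 τ hτ.1 x).trans ?_
      have : ENNReal.ofReal c = ∫⁻ y, ENNReal.ofReal (hk d τ x y) * ENNReal.ofReal c := by
        rw [lintegral_mul_const _ (hkm1 τ x), lint_hk d hτ.1, one_mul]
      have hpm : Measurable (fun y => ENNReal.ofReal (hk d τ x y) * ENNReal.ofReal (G y - c)) :=
        (hkm1 τ x).mul hGc
      rw [this, ← lintegral_add_right _ hpm]
      refine lintegral_mono fun y => ?_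
      rw [← mul_add]
      gcongr
      calc ENNReal.ofReal (G y) = ENNReal.ofReal (c + (G y - c)) := by congr 1; ring
        _ ≤ _ := ENNReal.ofReal_add_le
    have hhigh : ∫⁻ τ in Set.Ioi T, ENNReal.ofReal (τ ^ (a - 1)) * P τ x ≤
        ENNReal.ofReal (B * (T ^ (-e) / e)) := by
      rw [ENNReal.ofReal_mul hB.le, ← lint_Ioi_rpow he hT,
        ← lintegral_const_mul' _ _ ENNReal.ofReal_ne_top]
      refine setLIntegral_mono' measurableSet_Ioi fun τ hτ => ?_
      have hτ0 : 0 < τ := hT.trans hτ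
      calc ENNReal.ofReal (τ ^ (a - 1)) * P τ x
          ≤ ENNReal.ofReal (τ ^ (a - 1)) * ENNReal.ofReal (B * τ ^ (-(a + e))) := by
            gcongr; exact hP2 τ hτ0 x
        _ = ENNReal.ofReal B * ENNReal.ofReal (τ ^ (-e - 1)) := by
            rw [← ENNReal.ofReal_mul (by positivity), ← ENNReal.ofReal_mul hB.le]
            congr 1
            have : -e - 1 = (a - 1) + -(a + e) := by ring
            rw [this, Real.rpow_add hτ0]; ring
    calc ENNReal.ofReal A * ∫⁻ τ in Set.Ioi (0 : ℝ), ENNReal.ofReal (τ ^ (a - 1)) * P τ x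
        ≤ ENNReal.ofReal A * ((ENNReal.ofReal (c * (T ^ a / a)) + V x) +
            ENNReal.ofReal (B * (T ^ (-e) / e))) := by
          gcongr
          rw [hsplit]
          exact (lintegral_union_le _ _ _).trans (add_le_add hlow hhigh)
      _ = ENNReal.ofReal (A * (c * (T ^ a / a))) + ENNReal.ofReal (A * (B * (T ^ (-e) / e))) +
            ENNReal.ofReal A * V x := by
          rw [ENNReal.ofReal_mul hA.le, ENNReal.ofReal_mul hA.le]; ring
      _ ≤ _ := by gcongr
  have hsub : {x | lam ≤ U x} ⊆ {x | ENNReal.ofReal (lam / 2) ≤ ENNReal.ofReal A * V x} := by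
    intro x hx
    have hx' : lam ≤ U x := hx
    have h := (ENNReal.ofReal_le_ofReal hx').trans (hpt x)
    rw [← ENNReal.ofReal_add (by positivity) (by positivity)] at h
    have e1 : lam = lam / 2 + lam / 2 := by ring
    have e2 : lam / 4 + lam / 4 = lam / 2 := by ring
    rw [e2] at h
    nth_rewrite 1 [e1] at h
    rw [ENNReal.ofReal_add (by positivity) (by positivity)] at h
    exact (ENNReal.add_le_add_iff_left ENNReal.ofReal_ne_top).1 h
  refine (measure_mono hsub).trans ?_
  refine (meas_ge_le_lintegral_div (hVm.const_mul _).aemeasurable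
    (by simpa using hlam) ENNReal.ofReal_ne_top).trans ?_
  rw [lintegral_const_mul _ hVm, hVint, ← mul_assoc, ← ENNReal.ofReal_mul hA.le, div_eq_mul_inv,
    mul_right_comm, ← ENNReal.ofReal_inv_of_pos (by positivity),
    ← ENNReal.ofReal_mul (by positivity)]
  apply le_of_eq
  congr 2
  field_simp

lemma inner_int {K m q r g : ℝ} (hK : 0 < K) (hm : 0 < m) (hmq : m < q) (hr : r = q / m)
    (hg : 0 ≤ g) :
    ∫⁻ t in Set.Ioi (0 : ℝ), ENNReal.ofReal (1 / (2 * (K * t ^ m))) * ENNReal.ofReal (g - K * t ^ m) *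
      ENNReal.ofReal (t ^ (q - 1)) ≤ ENNReal.ofReal (1 / (2 * (q - m)) * K ^ (-r) * g ^ r) := by
  have hr0 : 0 < r := by rw [hr]; exact div_pos (hm.trans hmq) hm
  set Λ := (g / K) ^ (1 / m) with hΛ
  have hΛ0 : 0 ≤ Λ := by positivity
  have hqm : 0 < q - m := by linarith
  have hΛm : Λ ^ m = g / K := by
    rw [hΛ, ← Real.rpow_mul (by positivity), one_div_mul_cancel hm.ne', Real.rpow_one]
  calc _ ≤ ∫⁻ t in Set.Ioi (0 : ℝ), (Set.Ioc 0 Λ).indicator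
        (fun t => ENNReal.ofReal (g / (2 * K)) * ENNReal.ofReal (t ^ ((q - m) - 1))) t := by
        refine setLIntegral_mono' measurableSet_Ioi fun t ht => ?_
        have ht0 : 0 < t := ht
        by_cases htΛ : t ≤ Λ
        · rw [Set.indicator_of_mem (show t ∈ Set.Ioc 0 Λ from ⟨ht0, htΛ⟩)]
          have htm : 0 < t ^ m := by positivity
          have hle : ENNReal.ofReal (g - K * t ^ m) ≤ ENNReal.ofReal g := by
            apply ENNReal.ofReal_le_ofReal
            have : 0 < K * t ^ m := by positivity
            linarith
          refine (mul_le_mul_left (mul_le_mul_right hle _) _).trans (le_of_eq ?_)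
          rw [← ENNReal.ofReal_mul (by positivity), ← ENNReal.ofReal_mul (by positivity),
            ← ENNReal.ofReal_mul (by positivity)]
          have e1 : t ^ (q - m - 1) = t ^ (q - 1) / t ^ m := by
            rw [← Real.rpow_sub ht0]; congr 1; ring
          rw [e1]
          congr 1
          field_simp
        · push Not at htΛ
          have : g - K * t ^ m ≤ 0 := by
            have h1 : Λ ^ m ≤ t ^ m := by gcongr
            rw [hΛm, div_le_iff₀ hK] at h1
            linarith
          rw [ENNReal.ofReal_of_nonpos this]
          simp
    _ = ∫⁻ t in Set.Ioc (0 : ℝ) Λ,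
        ENNReal.ofReal (g / (2 * K)) * ENNReal.ofReal (t ^ ((q - m) - 1)) := by
        rw [lintegral_indicator measurableSet_Ioc, Measure.restrict_restrict measurableSet_Ioc,
          Set.inter_eq_left.2 (fun t ht => ht.1)]
    _ = ENNReal.ofReal (g / (2 * K) * (Λ ^ (q - m) / (q - m))) := by
        rw [lintegral_const_mul' _ _ ENNReal.ofReal_ne_top, lint_Ioc_rpow hqm hΛ0,
          ← ENNReal.ofReal_mul (by positivity)]
    _ ≤ _ := by
        apply ENNReal.ofReal_le_ofReal
        have e1 : K ^ (-r) * g ^ r = (g / K) ^ r := by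
          rw [Real.div_rpow hg hK.le, Real.rpow_neg hK.le]; field_simp
        have e2 : (g / K) * Λ ^ (q - m) = (g / K) ^ r := by
          rw [hΛ, ← Real.rpow_mul (by positivity)]
          have : r = 1 + 1 / m * (q - m) := by rw [hr]; field_simp; ring
          rw [this, Real.rpow_add' (by positivity) (by rw [← this]; exact hr0.ne'), Real.rpow_one]
        rw [mul_assoc, e1, ← e2]
        apply le_of_eq
        field_simp

lemma strong {d : ℕ} {a e A q r : ℝ} (ha : 0 < a) (he : 0 < e) (hA : 0 < A) (hr : 1 < r)
    (hrq : r < q) (hqr : q / r = 1 + a / e) :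
    ∃ C : ℝ, 0 < C ∧ ∀ (B : ℝ) (U G : EuclideanSpace ℝ (Fin d) → ℝ)
      (P : ℝ → EuclideanSpace ℝ (Fin d) → ℝ≥0∞), 0 < B → Measurable U → Measurable G →
      (∀ x, 0 ≤ U x) → (∀ x, 0 ≤ G x) →
      (∀ τ, 0 < τ → ∀ x, P τ x ≤ ∫⁻ y, ENNReal.ofReal (hk d τ x y) * ENNReal.ofReal (G y)) →
      (∀ τ, 0 < τ → ∀ x, P τ x ≤ ENNReal.ofReal (B * τ ^ (-(a + e)))) →
      (∀ x, ENNReal.ofReal (U x) ≤ ENNReal.ofReal A *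
        ∫⁻ τ in Set.Ioi (0 : ℝ), ENNReal.ofReal (τ ^ (a - 1)) * P τ x) →
      ∫⁻ x, ENNReal.ofReal (U x ^ q) ≤ ENNReal.ofReal (C * B ^ (q - r)) *
        ∫⁻ x, ENNReal.ofReal (G x ^ r) := by
  have hr0 : 0 < r := by linarith
  have hq0 : 0 < q := by linarith
  set m := q / r with hm
  have hm0 : 0 < m := by positivity
  have hmq : m < q := by rw [hm, div_lt_iff₀ hr0]; nlinarith
  set K1 : ℝ := a / (4 * A) * (e / (4 * A)) ^ (a / e) with hK1
  have hK10 : 0 < K1 := by positivity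
  have hqm : 0 < q - m := by linarith
  refine ⟨q * (1 / (2 * (q - m))) * K1 ^ (-r), by positivity, ?_⟩
  intro B U G P hB hU hG hU0 hG0 hP1 hP2 hUP
  set K : ℝ := K1 * B ^ (-(a / e)) with hK
  have hK0 : 0 < K := by positivity
  have hweak : ∀ t : ℝ, 0 < t → volume {x | t ≤ U x} ≤ ENNReal.ofReal (1 / (2 * (K * t ^ m))) *
      ∫⁻ y, ENNReal.ofReal (G y - K * t ^ m) := by
    intro t ht
    set T : ℝ := (e * t / (4 * A * B)) ^ (-(1 / e)) with hT
    have hT0 : 0 < T := by positivity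
    have hTe : T ^ (-e) = e * t / (4 * A * B) := by
      rw [hT, ← Real.rpow_mul (by positivity)]
      have : -(1 / e) * -e = 1 := by field_simp
      rw [this, Real.rpow_one]
    have hTa : T ^ a = ((e * t / (4 * A * B)) ^ (a / e))⁻¹ := by
      rw [hT, ← Real.rpow_mul (by positivity), ← Real.rpow_neg (by positivity)]
      congr 1; field_simp
    have hKt : K * t ^ m = a * t / (4 * A) * (T ^ a)⁻¹ := by
      rw [hTa, inv_inv, hK, hK1, hqr, Real.rpow_add ht, Real.rpow_one]
      have : e * t / (4 * A * B) = (e / (4 * A)) * t * B⁻¹ := by field_simp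
      rw [this, Real.mul_rpow (by positivity) (by positivity),
        Real.mul_rpow (by positivity) (by positivity), Real.inv_rpow hB.le, Real.rpow_neg hB.le]
      field_simp
    have hTa0 : 0 < T ^ a := by positivity
    have := weak (c := K * t ^ m) (T := T) (lam := t) ha he hA hB hT0 (by positivity) ht hG
      hP1 hP2 hUP (by rw [hKt]; apply le_of_eq; field_simp)
      (by rw [hTe]; apply le_of_eq; field_simp)
    refine this.trans (le_of_eq ?_)
    congr 2
    rw [hKt]; field_simp; norm_num
  rw [lintegral_rpow_eq_lintegral_meas_le_mul volume (Filter.Eventually.of_forall hU0)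
    hU.aemeasurable hq0]
  have hswap : ∫⁻ t in Set.Ioi (0 : ℝ), volume {x | t ≤ U x} * ENNReal.ofReal (t ^ (q - 1)) ≤
      ∫⁻ y, ENNReal.ofReal (1 / (2 * (q - m)) * K ^ (-r)) * ENNReal.ofReal (G y ^ r) := by
    calc _ ≤ ∫⁻ t in Set.Ioi (0 : ℝ), ∫⁻ y, ENNReal.ofReal (1 / (2 * (K * t ^ m))) *
          ENNReal.ofReal (G y - K * t ^ m) * ENNReal.ofReal (t ^ (q - 1)) := by
          refine setLIntegral_mono' measurableSet_Ioi fun t ht => ?_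
          rw [lintegral_mul_const' _ _ ENNReal.ofReal_ne_top,
            lintegral_const_mul' _ _ ENNReal.ofReal_ne_top]
          gcongr
          exact hweak t ht
      _ = ∫⁻ y, ∫⁻ t in Set.Ioi (0 : ℝ), ENNReal.ofReal (1 / (2 * (K * t ^ m))) *
          ENNReal.ofReal (G y - K * t ^ m) * ENNReal.ofReal (t ^ (q - 1)) := by
          rw [lintegral_lintegral_swap]
          apply Measurable.aemeasurable
          fun_prop
      _ ≤ _ := by
          refine lintegral_mono fun y => ?_
          simp only
          rw [← ENNReal.ofReal_mul (by positivity)]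
          exact inner_int hK0 hm0 hmq (by rw [hm]; field_simp) (hG0 y)
  refine (mul_le_mul_right hswap _).trans ?_
  rw [lintegral_const_mul' _ _ ENNReal.ofReal_ne_top, ← mul_assoc, ← ENNReal.ofReal_mul hq0.le]
  apply le_of_eq
  congr 2
  rw [hK, Real.mul_rpow (by positivity) (by positivity), ← Real.rpow_mul hB.le]
  have : -(a / e) * -r = q - r := by
    have : a / e = q / r - 1 := by linarith
    rw [this]; field_simp
  rw [this]; ring

lemma heat_le_f {d : ℕ} {f g : EuclideanSpace ℝ (Fin d) → ℂ} (hf : Integrable f)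
    (hfF : Integrable (𝓕 f)) {b c : ℝ} (hb : 0 < b) (hc : 0 < c) (hbc : b + c = (d : ℝ) / 2)
    (hfg : ∀ ξ, 𝓕 g ξ = (((1 + ‖ξ‖ ^ 2) ^ (-b) : ℝ) : ℂ) * 𝓕 f ξ)
    {τ : ℝ} (hτ : 0 < τ) (x : EuclideanSpace ℝ (Fin d)) :
    ‖heat g τ x‖ₑ ≤ ENNReal.ofReal
      ((1 / Real.Gamma b * π ^ ((d : ℝ) / 2) * (1 / b + 1 / c)) * τ ^ (-c)) * ∫⁻ y, ‖f y‖ₑ := by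
  have hΓ := Real.Gamma_pos_of_pos hb
  set F := ∫⁻ y, ‖f y‖ₑ with hF
  have hFtop : F ≠ ⊤ := hf.2.ne
  have hG : Integrable (fun ξ : EuclideanSpace ℝ (Fin d) => ((Real.exp (-τ * ‖ξ‖ ^ 2) : ℝ) : ℂ) *
      (Complex.exp (2 * π * Complex.I * (inner ℝ x ξ : ℝ)) * 𝓕 f ξ)) := by
    refine hfF.mono ?_ (Filter.Eventually.of_forall fun ξ => ?_)
    · refine AEStronglyMeasurable.mul (Continuous.aestronglyMeasurable (by fun_prop)) ?_
      exact AEStronglyMeasurable.mul (Continuous.aestronglyMeasurable (by fun_prop))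
        hfF.aestronglyMeasurable
    · have e1 : ‖Complex.exp (2 * π * Complex.I * (inner ℝ x ξ : ℝ))‖ = 1 := by
        rw [Complex.norm_exp]; simp
      rw [norm_mul, norm_mul, e1, one_mul, Complex.norm_real, Real.norm_of_nonneg (by positivity)]
      apply mul_le_of_le_one_left (norm_nonneg _)
      rw [Real.exp_le_one_iff]
      nlinarith [mul_nonneg hτ.le (sq_nonneg ‖ξ‖)]
  have h1 : heat g τ x = ∫ ξ, (((1 + ‖ξ‖ ^ 2) ^ (-b) : ℝ) : ℂ) *
      (((Real.exp (-τ * ‖ξ‖ ^ 2) : ℝ) : ℂ) *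
      (Complex.exp (2 * π * Complex.I * (inner ℝ x ξ : ℝ)) * 𝓕 f ξ)) := by
    unfold heat
    congr 1; ext ξ
    rw [hfg]; ring
  rw [h1]
  refine (subord hb hG).trans ?_
  have h2 : ∀ σ : ℝ, ∫ ξ : EuclideanSpace ℝ (Fin d), ((Real.exp (-σ * ‖ξ‖ ^ 2) : ℝ) : ℂ) *
      (((Real.exp (-τ * ‖ξ‖ ^ 2) : ℝ) : ℂ) *
      (Complex.exp (2 * π * Complex.I * (inner ℝ x ξ : ℝ)) * 𝓕 f ξ)) = heat f (τ + σ) x := by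
    intro σ
    unfold heat
    congr 1; ext ξ
    rw [← mul_assoc, ← Complex.ofReal_mul, ← Real.exp_add]
    congr 4; ring
  simp_rw [h2]
  set D : ℝ := (d : ℝ) / 2 with hD
  have hD0 : 0 < D := by rw [← hbc]; positivity
  have hsplit : Set.Ioi (0 : ℝ) = Set.Ioc 0 τ ∪ Set.Ioi τ := (Set.Ioc_union_Ioi_eq_Ioi hτ.le).symm
  have hlow : ∫⁻ σ in Set.Ioc (0 : ℝ) τ, ENNReal.ofReal (σ ^ (b - 1)) * ‖heat f (τ + σ) x‖ₑ ≤
      ENNReal.ofReal (π ^ D * τ ^ (-c) * (1 / b)) * F := by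
    calc _ ≤ ∫⁻ σ in Set.Ioc (0 : ℝ) τ, ENNReal.ofReal (σ ^ (b - 1)) *
          (ENNReal.ofReal (π ^ D * τ ^ (-D)) * F) := by
          refine setLIntegral_mono' measurableSet_Ioc fun σ hσ => ?_
          gcongr
          refine (heat_le_one hf (by linarith [hσ.1]) x).trans ?_
          gcongr
          rw [Real.div_rpow (by positivity) (by linarith [hσ.1]), div_eq_mul_inv,
            ← Real.rpow_neg (by linarith [hσ.1])]
          gcongr ?_ * ?_
          exact Real.rpow_le_rpow_of_nonpos hτ (by linarith [hσ.1]) (by linarith)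
      _ = _ := by
          rw [lintegral_mul_const' _ _ (ENNReal.mul_ne_top ENNReal.ofReal_ne_top hFtop),
            lint_Ioc_rpow hb hτ.le, ← mul_assoc, ← ENNReal.ofReal_mul (by positivity)]
          congr 2
          have : -c = b + -D := by linarith
          rw [this, Real.rpow_add hτ]; ring
  have hhigh : ∫⁻ σ in Set.Ioi τ, ENNReal.ofReal (σ ^ (b - 1)) * ‖heat f (τ + σ) x‖ₑ ≤
      ENNReal.ofReal (π ^ D * τ ^ (-c) * (1 / c)) * F := by
    calc _ ≤ ∫⁻ σ in Set.Ioi τ, ENNReal.ofReal (σ ^ (-c - 1)) *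
          (ENNReal.ofReal (π ^ D) * F) := by
          refine setLIntegral_mono' measurableSet_Ioi fun σ hσ => ?_
          have hσ' : τ < σ := hσ
          have hσ0 : 0 < σ := hτ.trans hσ'
          have hts : 0 < τ + σ := by positivity
          calc ENNReal.ofReal (σ ^ (b - 1)) * ‖heat f (τ + σ) x‖ₑ ≤
              ENNReal.ofReal (σ ^ (b - 1)) * (ENNReal.ofReal (π ^ D * σ ^ (-D)) * F) := by
                gcongr
                refine (heat_le_one hf hts x).trans ?_
                gcongr
                rw [Real.div_rpow (by positivity) hts.le, div_eq_mul_inv,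
                  ← Real.rpow_neg hts.le]
                gcongr ?_ * ?_
                exact Real.rpow_le_rpow_of_nonpos hσ0 (by linarith) (by linarith)
            _ = _ := by
                rw [← mul_assoc, ← mul_assoc, ← ENNReal.ofReal_mul (by positivity),
                  ← ENNReal.ofReal_mul (by positivity)]
                congr 2
                have : -c - 1 = (b - 1) + -D := by linarith
                rw [this, Real.rpow_add hσ0]; ring
      _ = _ := by
          rw [lintegral_mul_const' _ _ (ENNReal.mul_ne_top ENNReal.ofReal_ne_top hFtop),
            lint_Ioi_rpow hc hτ, ← mul_assoc, ← ENNReal.ofReal_mul (by positivity)]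
          congr 2
          ring
  calc _ ≤ ENNReal.ofReal (1 / Real.Gamma b) * (ENNReal.ofReal (π ^ D * τ ^ (-c) * (1 / b)) * F +
        ENNReal.ofReal (π ^ D * τ ^ (-c) * (1 / c)) * F) := by
        gcongr
        rw [hsplit]
        exact (lintegral_union_le _ _ _).trans (add_le_add hlow hhigh)
    _ = _ := by
        rw [← add_mul, ← ENNReal.ofReal_add (by positivity) (by positivity), ← mul_assoc,
          ← ENNReal.ofReal_mul (by positivity)]
        congr 2
        ring

/-- Bessel potential of a Schwartz function as a Schwartz function -/
noncomputable def bess {d : ℕ} (s : ℝ) (u : SchwartzMap (EuclideanSpace ℝ (Fin d)) ℂ) :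
    SchwartzMap (EuclideanSpace ℝ (Fin d)) ℂ :=
  𝓕⁻ (SchwartzMap.smulLeftCLM ℂ
    (fun ξ : EuclideanSpace ℝ (Fin d) => (((1 + ‖ξ‖ ^ 2) ^ s : ℝ) : ℂ)) (𝓕 u))

lemma htg {d : ℕ} (s : ℝ) : (fun ξ : EuclideanSpace ℝ (Fin d) =>
    (((1 + ‖ξ‖ ^ 2) ^ s : ℝ) : ℂ)).HasTemperateGrowth := by
  have := Function.hasTemperateGrowth_one_add_norm_sq_rpow (EuclideanSpace ℝ (Fin d)) s
  fun_prop

lemma bess_coe {d : ℕ} (s : ℝ) (u : SchwartzMap (EuclideanSpace ℝ (Fin d)) ℂ) :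
    (fun x => 𝓕⁻ (fun ξ => (((1 + ‖ξ‖ ^ 2) ^ s : ℝ) : ℂ) * 𝓕 (⇑u) ξ) x) = ⇑(bess s u) := by
  unfold bess
  rw [SchwartzMap.fourierInv_coe, SchwartzMap.smulLeftCLM_apply (htg s)]
  rfl

lemma bess_fourier {d : ℕ} (s : ℝ) (u : SchwartzMap (EuclideanSpace ℝ (Fin d)) ℂ)
    (ξ : EuclideanSpace ℝ (Fin d)) :
    𝓕 (⇑(bess s u)) ξ = (((1 + ‖ξ‖ ^ 2) ^ s : ℝ) : ℂ) * 𝓕 (⇑u) ξ := by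
  rw [← SchwartzMap.fourier_coe]
  unfold bess
  rw [FourierTransform.fourier_fourierInv_eq, SchwartzMap.smulLeftCLM_apply (htg s)]
  rfl

lemma fourier_integrable {d : ℕ} (u : SchwartzMap (EuclideanSpace ℝ (Fin d)) ℂ) :
    Integrable (𝓕 (⇑u)) := by
  rw [← SchwartzMap.fourier_coe]; exact (𝓕 u).integrable

lemma u_le {d : ℕ} (u g : SchwartzMap (EuclideanSpace ℝ (Fin d)) ℂ) {a : ℝ} (ha : 0 < a)
    (hug : ∀ ξ, 𝓕 (⇑u) ξ = (((1 + ‖ξ‖ ^ 2) ^ (-a) : ℝ) : ℂ) * 𝓕 (⇑g) ξ)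
    (x : EuclideanSpace ℝ (Fin d)) :
    ‖u x‖ₑ ≤ ENNReal.ofReal (1 / Real.Gamma a) *
      ∫⁻ τ in Set.Ioi (0 : ℝ), ENNReal.ofReal (τ ^ (a - 1)) * ‖heat g τ x‖ₑ := by
  have h1 : u x = ∫ ξ, (((1 + ‖ξ‖ ^ 2) ^ (-a) : ℝ) : ℂ) *
      (Complex.exp (2 * π * Complex.I * (inner ℝ x ξ : ℝ)) * 𝓕 (⇑g) ξ) := by
    have h0 : u = 𝓕⁻ (𝓕 u) := (FourierTransform.fourierInv_fourier_eq u).symm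
    have h2 : u x = 𝓕⁻ (𝓕 (⇑u)) x := by
      conv_lhs => rw [h0]
      rw [SchwartzMap.fourierInv_coe, SchwartzMap.fourier_coe]
    rw [h2, Real.fourierInv_eq']
    congr 1; ext ξ
    rw [hug, smul_eq_mul, real_inner_comm]
    push_cast
    have : (2 * π * (inner ℝ x ξ : ℝ) * Complex.I : ℂ) =
      2 * π * Complex.I * (inner ℝ x ξ : ℝ) := by ring
    rw [this]; ring
  rw [h1]
  refine subord ha ?_
  refine (fourier_integrable g).mono ?_ (Filter.Eventually.of_forall fun ξ => ?_)
  · exact AEStronglyMeasurable.mul (Continuous.aestronglyMeasurable (by fun_prop))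
      (fourier_integrable g).aestronglyMeasurable
  · have e1 : ‖Complex.exp (2 * π * Complex.I * (inner ℝ x ξ : ℝ))‖ = 1 := by
      rw [Complex.norm_exp]; simp
    rw [norm_mul, e1, one_mul]

lemma eLp_eq {d : ℕ} (h : SchwartzMap (EuclideanSpace ℝ (Fin d)) ℂ) {p : ℝ} (hp : 0 < p) :
    eLpNorm (⇑h) (ENNReal.ofReal p) volume = (∫⁻ x, ‖h x‖ₑ ^ p) ^ (1 / p) := by
  rw [eLpNorm_eq_lintegral_rpow_enorm_toReal (by simpa using hp) ENNReal.ofReal_ne_top,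
    ENNReal.toReal_ofReal hp.le]

end GN

/-- Endpoint Gagliardo-Nirenberg inequality in the case `r₁ = 1 < r₂ < q`
(Proposition `prop:LargeFreqInterpolated`). -/
theorem gagliardo_nirenberg_endpoint_one_r
    (d : ℕ) (hd : 1 ≤ d) (r₂ q : ℝ) (hr₂ : 1 < r₂) (hrq : r₂ < q)
    (κ : ℝ) (hκ1 : r₂ / q ≤ κ) (hκ2 : κ ≤ 1) :
    ∃ C : ℝ, 0 < C ∧ ∀ u : SchwartzMap (EuclideanSpace ℝ (Fin d)) ℂ,
      eLpNorm (⇑u) (ENNReal.ofReal q) volume ≤ ENNReal.ofReal C *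
        eLpNorm (fun x => 𝓕⁻ (fun ξ =>
          (((1 + ‖ξ‖ ^ 2) ^ ((d * (1 - 1 / q)) / 2) : ℝ) : ℂ) * 𝓕 (⇑u) ξ) x) 1 volume ^ (1 - κ) *
        eLpNorm (fun x => 𝓕⁻ (fun ξ =>
          (((1 + ‖ξ‖ ^ 2) ^ ((d * (1 / r₂ - 1 / q)) / 2) : ℝ) : ℂ) * 𝓕 (⇑u) ξ) x)
          (ENNReal.ofReal r₂) volume ^ κ := by
  have hr0 : 0 < r₂ := by linarith
  have hq0 : 0 < q := by linarith
  have hd0 : (0 : ℝ) < d := by exact_mod_cast hd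
  set s : ℝ := (d * (1 - 1 / q)) / 2 with hs
  set a : ℝ := (d * (1 / r₂ - 1 / q)) / 2 with ha
  set c : ℝ := d / (2 * r₂) with hc
  set e : ℝ := d / (2 * q) with he
  set b : ℝ := s - a with hb
  have hc0 : 0 < c := by positivity
  have he0 : 0 < e := by positivity
  have ha0 : 0 < a := by
    have : 1 / q < 1 / r₂ := one_div_lt_one_div_of_lt hr0 hrq
    have : 0 < 1 / r₂ - 1 / q := by linarith
    positivity
  have hb' : b = d / 2 * (1 - 1 / r₂) := by rw [hb, hs, ha]; ring
  have hb0 : 0 < b := by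
    have : 1 / r₂ < 1 := by rw [div_lt_one hr0]; exact hr₂
    have : 0 < 1 - 1 / r₂ := by linarith
    rw [hb']; positivity
  have hbc : b + c = (d : ℝ) / 2 := by rw [hb', hc]; field_simp; ring
  have hae : a + e = c := by rw [ha, hc, he]; field_simp; ring
  have hqr : q / r₂ = 1 + a / e := by rw [ha, he]; field_simp; ring
  have hΓa := Real.Gamma_pos_of_pos ha0
  have hΓb := Real.Gamma_pos_of_pos hb0
  obtain ⟨C0, hC0, hstrong⟩ := GN.strong (d := d) (A := 1 / Real.Gamma a) ha0 he0 (by positivity)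
    hr₂ hrq hqr
  set C1 : ℝ := 1 / Real.Gamma b * π ^ ((d : ℝ) / 2) * (1 / b + 1 / c) with hC1
  have hC10 : 0 < C1 := by positivity
  set C2 : ℝ := π ^ c with hC2
  have hC20 : 0 < C2 := by positivity
  set C3 : ℝ := C1 + C2 with hC3
  have hC30 : 0 < C3 := by positivity
  have hrq1 : r₂ / q < 1 := by rw [div_lt_one hq0]; exact hrq
  have hrq2 : 0 < 1 - r₂ / q := by linarith
  set θ : ℝ := (1 - κ) / (1 - r₂ / q) with hθ
  have hθ0 : 0 ≤ θ := div_nonneg (by linarith) hrq2.le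
  have hθ1 : θ ≤ 1 := by rw [hθ, div_le_one hrq2]; linarith
  refine ⟨C0 ^ (1 / q) * C3 ^ (1 - r₂ / q), by positivity, ?_⟩
  intro u
  rw [GN.bess_coe, GN.bess_coe]
  set f := GN.bess s u with hf
  set g := GN.bess a u with hg
  have hfg : ∀ ξ, 𝓕 (⇑g) ξ = (((1 + ‖ξ‖ ^ 2) ^ (-b) : ℝ) : ℂ) * 𝓕 (⇑f) ξ := by
    intro ξ
    rw [hg, hf, GN.bess_fourier, GN.bess_fourier, ← mul_assoc, ← Complex.ofReal_mul,
      ← Real.rpow_add (by positivity)]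
    congr 4; rw [hb]; ring
  have hug : ∀ ξ, 𝓕 (⇑u) ξ = (((1 + ‖ξ‖ ^ 2) ^ (-a) : ℝ) : ℂ) * 𝓕 (⇑g) ξ := by
    intro ξ
    rw [hg, GN.bess_fourier, ← mul_assoc, ← Complex.ofReal_mul,
      ← Real.rpow_add (by positivity)]
    simp
  have hfint : Integrable (⇑f) := f.integrable
  have hgint : Integrable (⇑g) := g.integrable
  set F := eLpNorm (⇑f) 1 volume with hF
  set Gn := eLpNorm (⇑g) (ENNReal.ofReal r₂) volume with hGn
  have hFtop : F ≠ ⊤ := (f.memLp 1 volume).2.ne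
  have hGtop : Gn ≠ ⊤ := (g.memLp _ volume).2.ne
  have hFeq : ∫⁻ y, ‖f y‖ₑ = F := by rw [hF, eLpNorm_one_eq_lintegral_enorm]
  have hGeq : ∫⁻ y, ‖g y‖ₑ ^ r₂ = Gn ^ r₂ := by
    rw [hGn, GN.eLp_eq g hr0, ← ENNReal.rpow_mul, one_div_mul_cancel hr0.ne', ENNReal.rpow_one]
  set F' := F.toReal with hF'
  set G' := Gn.toReal with hG'
  have hF0 : 0 ≤ F' := ENNReal.toReal_nonneg
  have hG0 : 0 ≤ G' := ENNReal.toReal_nonneg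
  have hFo : F = ENNReal.ofReal F' := (ENNReal.ofReal_toReal hFtop).symm
  have hGo : Gn = ENNReal.ofReal G' := (ENNReal.ofReal_toReal hGtop).symm
  have hh1 : ∀ τ, 0 < τ → ∀ x, ‖GN.heat g τ x‖ ≤ C3 * τ ^ (-c) * F' := by
    intro τ hτ x
    have h := GN.heat_le_f hfint (GN.fourier_integrable f) hb0 hc0 hbc hfg hτ x
    rw [hFeq, hFo, ← ENNReal.ofReal_mul (by positivity), ← ofReal_norm,
      ENNReal.ofReal_le_ofReal_iff (by positivity)] at h
    refine h.trans ?_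
    gcongr
    linarith
  have hh2 : ∀ τ, 0 < τ → ∀ x, ‖GN.heat g τ x‖ ≤ C3 * τ ^ (-c) * G' := by
    intro τ hτ x
    have h := GN.heat_le_r hgint g.continuous hτ hr₂ x
    rw [hGeq, ENNReal.mul_rpow_of_nonneg _ _ (by positivity), ← ENNReal.rpow_mul,
      mul_one_div_cancel hr0.ne', ENNReal.rpow_one, ENNReal.ofReal_rpow_of_nonneg (by positivity)
      (by positivity), hGo, ← ENNReal.ofReal_mul (by positivity), ← ofReal_norm,
      ENNReal.ofReal_le_ofReal_iff (by positivity)] at h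
    refine h.trans ?_
    have e1 : ((π / τ) ^ ((d : ℝ) / 2)) ^ (1 / r₂) = C2 * τ ^ (-c) := by
      rw [← Real.rpow_mul (by positivity)]
      have : (d : ℝ) / 2 * (1 / r₂) = c := by rw [hc]; field_simp
      rw [this, Real.div_rpow (by positivity) hτ.le, Real.rpow_neg hτ.le, div_eq_mul_inv]
    rw [e1]
    gcongr
    linarith
  have hule : ∀ x, ‖u x‖ₑ ≤ ENNReal.ofReal (1 / Real.Gamma a) *
      ∫⁻ τ in Set.Ioi (0 : ℝ), ENNReal.ofReal (τ ^ (a - 1)) * ‖GN.heat g τ x‖ₑ :=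
    fun x => GN.u_le u g ha0 hug x
  by_cases hzero : F' = 0 ∨ G' = 0
  · have hheat : ∀ τ, 0 < τ → ∀ x, GN.heat g τ x = 0 := by
      intro τ hτ x
      rw [← norm_le_zero_iff]
      rcases hzero with h | h
      · have := hh1 τ hτ x; rwa [h, mul_zero] at this
      · have := hh2 τ hτ x; rwa [h, mul_zero] at this
    have hu0 : ⇑u = 0 := by
      ext x
      have h := hule x
      have h0 : ∫⁻ τ in Set.Ioi (0 : ℝ), ENNReal.ofReal (τ ^ (a - 1)) * ‖GN.heat g τ x‖ₑ = 0 := by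
        rw [setLIntegral_congr_fun (g := fun _ => 0) measurableSet_Ioi]
        · simp
        · intro τ hτ
          simp [hheat τ hτ x]
      rw [h0, mul_zero] at h
      simpa using h
    rw [hu0, eLpNorm_zero]
    exact zero_le
  push Not at hzero
  have hFp : 0 < F' := lt_of_le_of_ne hF0 (Ne.symm hzero.1)
  have hGp : 0 < G' := lt_of_le_of_ne hG0 (Ne.symm hzero.2)
  set B : ℝ := C3 * (F' ^ θ * G' ^ (1 - θ)) with hB
  have hBp : 0 < B := by positivity
  have hmain := hstrong B (fun x => ‖u x‖) (fun x => ‖g x‖) (fun τ x => ‖GN.heat g τ x‖ₑ) hBp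
    (u.continuous.norm.measurable) (g.continuous.norm.measurable)
    (fun x => norm_nonneg _) (fun x => norm_nonneg _)
    (by
      intro τ hτ x
      simp_rw [ofReal_norm]
      exact GN.heat_le hgint hτ x)
    (by
      intro τ hτ x
      rw [← ofReal_norm, hae]
      apply ENNReal.ofReal_le_ofReal
      set v := ‖GN.heat g τ x‖ with hv
      have hv0 : 0 ≤ v := norm_nonneg _
      set z := C3 * τ ^ (-c) with hz
      have hz0 : 0 < z := by positivity
      calc v = v ^ θ * v ^ (1 - θ) := by
            rw [← Real.rpow_add' hv0 (by simp)]; simp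
        _ ≤ (z * F') ^ θ * (z * G') ^ (1 - θ) := by
            have h1 := hh1 τ hτ x
            have h2 := hh2 τ hτ x
            have : 0 ≤ 1 - θ := by linarith
            gcongr
        _ = z ^ θ * z ^ (1 - θ) * (F' ^ θ * G' ^ (1 - θ)) := by
            rw [Real.mul_rpow hz0.le hF0, Real.mul_rpow hz0.le hG0]; ring
        _ = B * τ ^ (-c) := by
            rw [← Real.rpow_add hz0]
            simp only [add_sub_cancel, Real.rpow_one]
            rw [hz, hB]; ring)
    (by
      intro x
      rw [ofReal_norm]
      exact hule x)
  have e1 : ∀ (h : SchwartzMap (EuclideanSpace ℝ (Fin d)) ℂ) (p : ℝ) (hp : 0 < p),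
      ∫⁻ x, ENNReal.ofReal (‖h x‖ ^ p) = ∫⁻ x, ‖h x‖ₑ ^ p := by
    intro h p hp
    refine lintegral_congr fun x => ?_
    rw [← ENNReal.ofReal_rpow_of_nonneg (norm_nonneg _) hp.le, ofReal_norm]
  rw [e1 u q hq0, e1 g r₂ hr0, hGeq, hGo, ENNReal.ofReal_rpow_of_nonneg hG0 hr0.le,
    ← ENNReal.ofReal_mul (by positivity)] at hmain
  rw [GN.eLp_eq u hq0, hFo, hGo, ENNReal.ofReal_rpow_of_nonneg hF0 (by linarith),
    ENNReal.ofReal_rpow_of_nonneg hG0 (le_trans (by positivity) hκ1),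
    ← ENNReal.ofReal_mul (by positivity), ← ENNReal.ofReal_mul (by positivity)]
  refine (ENNReal.rpow_le_rpow hmain (by positivity)).trans ?_
  rw [ENNReal.ofReal_rpow_of_nonneg (by positivity) (by positivity)]
  apply ENNReal.ofReal_le_ofReal
  apply le_of_eq
  have hθm : θ * (1 - r₂ / q) = 1 - κ := by rw [hθ, div_mul_cancel₀ _ hrq2.ne']
  have x1 : (q - r₂) * (1 / q) = 1 - r₂ / q := by field_simp
  rw [Real.mul_rpow (by positivity) (by positivity), Real.mul_rpow (by positivity) (by positivity),
    ← Real.rpow_mul hBp.le, ← Real.rpow_mul hG0, x1, hB, Real.mul_rpow hC30.le (by positivity),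
    Real.mul_rpow (by positivity) (by positivity), ← Real.rpow_mul hF0, ← Real.rpow_mul hG0, hθm]
  have x2 : κ = (1 - θ) * (1 - r₂ / q) + r₂ * (1 / q) := by
    rw [sub_mul, hθm]; ring
  have x3 : G' ^ κ = G' ^ ((1 - θ) * (1 - r₂ / q)) * G' ^ (r₂ * (1 / q)) := by
    rw [← Real.rpow_add hGp, ← x2]
  rw [x3]; ring
end
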